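/- arXiv:2107.12814 — 2 statements merged into one kernel-verified Lean document; each statement's English description precedes it below -/
import Mathlib

section
/- Let n be a positive integer, k a positive integer, D ⊆ ℝ^n a measurable set with vol(D) < ∞, and f : D → ℝ a measurable function. Then the following are equivalent: (1) for almost every x₀ ∈ D, f has an approximate (k−1)-Taylor polynomial at x₀; (2) for every ε > 0 there exist M > 0 and a function u : ℝ^n → ℝ belonging to Lip(k, ℝ^n) with constant M such that vol{x ∈ D : u(x) ≠ f(x)} < ε. (This is the paper's main Theorem 1.2 specialized to the abelian Carnot group ℝ^n.) -/
open MeasureTheory Metric Filter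

noncomputable section

/-- `ℝ^n` with the Euclidean norm. -/
abbrev Euc (n : ℕ) := EuclideanSpace ℝ (Fin n)

/-- A set `S ⊆ ℝ^n` has density one at `x` if
`vol(S ∩ B(x,r))/vol(B(x,r)) → 1` as `r → 0⁺`. -/
def DensityOneAt {n : ℕ} (S : Set (Euc n)) (x : Euc n) : Prop :=
  Tendsto (fun r : ℝ => volume (S ∩ ball x r) / volume (ball x r))
    (nhdsWithin 0 (Set.Ioi 0)) (nhds 1)

/-- A set has density zero at `x` if its complement has density one at `x`. -/
def DensityZeroAt {n : ℕ} (S : Set (Euc n)) (x : Euc n) : Prop :=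
  DensityOneAt Sᶜ x

/-- Degree `|J|` of a multi-index. -/
def mdeg {n : ℕ} (J : Fin n → ℕ) : ℕ := ∑ i, J i

/-- Monomial `x^J = x₁^{j₁} ⋯ xₙ^{jₙ}`. -/
def mpow {n : ℕ} (x : Euc n) (J : Fin n → ℕ) : ℝ := ∏ i, (x i) ^ (J i)

/-- `J! = j₁! ⋯ jₙ!`. -/
def Jfact {n : ℕ} (J : Fin n → ℕ) : ℕ := ∏ i, Nat.factorial (J i)

/-- `p : ℝ^n → ℝ` is a polynomial function of (total) degree at most `k`. -/
def IsPolyFun (n k : ℕ) (p : Euc n → ℝ) : Prop :=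
  ∃ P : MvPolynomial (Fin n) ℝ, P.totalDegree ≤ k ∧
    ∀ x : Euc n, p x = MvPolynomial.eval (fun i => x i) P

/-- `f : D → ℝ` is approximately differentiable of order `k` at `x₀` (a density point
of `D`) with polynomial `p`: `p` has degree at most `k` and for every `ε > 0` the set
`{x ∈ D : |f x − p x| > ε ‖x − x₀‖^k}` has density zero at `x₀`. -/
def ApproxDiffAt {n : ℕ} (k : ℕ) (D : Set (Euc n)) (f : Euc n → ℝ)
    (x₀ : Euc n) (p : Euc n → ℝ) : Prop :=
  DensityOneAt D x₀ ∧ IsPolyFun n k p ∧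
    ∀ ε : ℝ, 0 < ε →
      DensityZeroAt {x | x ∈ D ∧ ε * ‖x - x₀‖ ^ k < |f x - p x|} x₀

/-- `f : D → ℝ` has an approximate `(k−1)`-Taylor polynomial at `x₀` (a density point
of `D`) with polynomial `p`: `p` has degree at most `k−1` and there is `M > 0` such that
`{x ∈ D : |f x − p x| > M ‖x − x₀‖^k}` has density zero at `x₀`. -/
def HasApproxTaylorAt {n : ℕ} (k : ℕ) (D : Set (Euc n)) (f : Euc n → ℝ)
    (x₀ : Euc n) (p : Euc n → ℝ) : Prop :=
  DensityOneAt D x₀ ∧ IsPolyFun n (k - 1) p ∧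
    ∃ M : ℝ, 0 < M ∧
      DensityZeroAt {x | x ∈ D ∧ M * ‖x - x₀‖ ^ k < |f x - p x|} x₀

/-- The finset of multi-indices `J` with `|J| ≤ k`. -/
def multiIdxLe (n k : ℕ) : Finset (Fin n → ℕ) :=
  (Fintype.piFinset fun _ : Fin n => Finset.range (k+1)).filter fun J => mdeg J ≤ k

/-- The finset of multi-indices `J` with `|J| < k` (i.e. `|J| ≤ k−1`). -/
def multiIdxLt (n k : ℕ) : Finset (Fin n → ℕ) :=
  (Fintype.piFinset fun _ : Fin n => Finset.range (k+1)).filter fun J => mdeg J < k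

/-- Partial derivative `∂g/∂xᵢ` (as a line derivative in the direction `eᵢ`). -/
def pd {n : ℕ} (i : Fin n) (g : Euc n → ℝ) : Euc n → ℝ :=
  fun x => lineDeriv ℝ g x (EuclideanSpace.single i 1)

/-- The list of directions `(1,…,1,2,…,2,…)` (direction `i` repeated `J i` times)
encoding the iterated partial derivative `∂^{|J|}/∂x₁^{j₁}⋯∂xₙ^{jₙ}`. -/
def multiList (n : ℕ) (J : Fin n → ℕ) : List (Fin n) :=
  (List.finRange n).flatMap fun i => List.replicate (J i) i

/-- Iterated partial derivatives along a list of coordinate directions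
(the head of the list is the outermost derivative). -/
def iterD {n : ℕ} : List (Fin n) → (Euc n → ℝ) → (Euc n → ℝ)
  | [], g => g
  | i :: L, g => pd i (iterD L g)

/-- The iterated partial derivatives along the list `L` all exist at every point. -/
def iterDExists {n : ℕ} : List (Fin n) → (Euc n → ℝ) → Prop
  | [], _ => True
  | i :: L, g => iterDExists L g ∧
      ∀ x : Euc n, LineDifferentiableAt ℝ (iterD L g) x (EuclideanSpace.single i 1)

/-- `D^J u = ∂^{|J|}u/∂x₁^{j₁}⋯∂xₙ^{jₙ}`. -/
def DJ {n : ℕ} (J : Fin n → ℕ) (u : Euc n → ℝ) : Euc n → ℝ := iterD (multiList n J) u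

/-- The Taylor polynomial of `u` of degree `k−1` centered at `x₀`:
`P_{x₀}(y) = Σ_{|I| ≤ k−1} D^I u(x₀) (y − x₀)^I / I!`. -/
def TaylorPoly {n : ℕ} (k : ℕ) (u : Euc n → ℝ) (x₀ : Euc n) : Euc n → ℝ :=
  fun y => ∑ I ∈ multiIdxLt n k, DJ I u x₀ * mpow (y - x₀) I / (Jfact I : ℝ)

/-- `u` belongs to `Lip(k, ℝ^n)` with constant `M`: all partial derivatives `D^J u`
with `|J| ≤ k−1` exist at every point, and for all such `J` and all `x, x₀`,
`|D^J u(x₀)| ≤ M` and `|D^J u(x) − D^J P_{x₀}(x)| ≤ M ‖x − x₀‖^{k−|J|}`. -/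
def MemLip (n k : ℕ) (M : ℝ) (u : Euc n → ℝ) : Prop :=
  (∀ J : Fin n → ℕ, mdeg J < k → iterDExists (multiList n J) u) ∧
  ∀ J : Fin n → ℕ, mdeg J < k → ∀ x x₀ : Euc n,
    |DJ J u x₀| ≤ M ∧
    |DJ J u x - DJ J (TaylorPoly k u x₀) x| ≤ M * ‖x - x₀‖ ^ (k - mdeg J)

/-- Truncation of `f` at level `h`: equals `f` where `−h < f < h`, equals `h` where
`f ≥ h`, and equals `−h` where `f ≤ −h`. -/
def trunc {n : ℕ} (h : ℕ) (f : Euc n → ℝ) : Euc n → ℝ :=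
  fun x => if (h : ℝ) ≤ f x then (h : ℝ) else if f x ≤ -(h : ℝ) then -(h : ℝ) else f x

open scoped ContDiff

/-! ### Iterated partial derivatives -/

/-- The standard basis vector. -/
def ee {n : ℕ} (i : Fin n) : Euc n := EuclideanSpace.single i 1

lemma norm_ee {n : ℕ} (i : Fin n) : ‖ee i‖ = 1 := by
  simp [ee]

lemma pd_of_diff {n : ℕ} (i : Fin n) {g : Euc n → ℝ} {x : Euc n} (h : DifferentiableAt ℝ g x) :
    pd i g x = fderiv ℝ g x (ee i) := h.lineDeriv_eq_fderiv

lemma iterD_aux {n : ℕ} (L : List (Fin n)) :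
    ∀ g : Euc n → ℝ, ContDiff ℝ (L.length : ℕ) g →
      iterDExists L g ∧ ∀ x, iterD L g x =
        iteratedFDeriv ℝ L.length g x (fun j => ee (L.get j)) := by
  induction L with
  | nil => intro g hg; simp [iterDExists, iterD]
  | cons i L ih =>
    intro g hg
    have hg' : ContDiff ℝ (L.length : ℕ) g := hg.of_le (by simp)
    obtain ⟨h1, h2⟩ := ih g hg'
    have hd : Differentiable ℝ (iteratedFDeriv ℝ L.length g) :=
      hg.differentiable_iteratedFDeriv (by
        simp only [List.length_cons]; exact_mod_cast Nat.lt_succ_self _)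
    have heq : iterD L g = fun x => iteratedFDeriv ℝ L.length g x (fun j => ee (L.get j)) :=
      funext h2
    have hf : ∀ x, HasFDerivAt (iterD L g)
        (((ContinuousMultilinearMap.apply ℝ (fun _ : Fin L.length => Euc n) ℝ
          (fun j => ee (L.get j)))).comp (fderiv ℝ (iteratedFDeriv ℝ L.length g) x)) x := by
      intro x
      rw [heq]
      exact ((ContinuousMultilinearMap.apply ℝ (fun _ : Fin L.length => Euc n) ℝ
          (fun j => ee (L.get j))).hasFDerivAt).comp x (hd x).hasFDerivAt
    refine ⟨⟨h1, fun x => (hf x).differentiableAt.lineDifferentiableAt⟩, fun x => ?_⟩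
    show pd i (iterD L g) x = _
    rw [pd_of_diff i (hf x).differentiableAt, (hf x).fderiv]
    simp only [List.length_cons]
    rw [iteratedFDeriv_succ_apply_left]
    rfl

lemma iterD_eq {n : ℕ} (L : List (Fin n)) {g : Euc n → ℝ} (hg : ContDiff ℝ (L.length : ℕ) g)
    (x : Euc n) : iterD L g x = iteratedFDeriv ℝ L.length g x (fun j => ee (L.get j)) :=
  (iterD_aux L g hg).2 x

lemma abs_iterD_le {n : ℕ} (L : List (Fin n)) {g : Euc n → ℝ}
    (hg : ContDiff ℝ (L.length : ℕ) g) (x : Euc n) :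
    |iterD L g x| ≤ ‖iteratedFDeriv ℝ L.length g x‖ := by
  rw [iterD_eq L hg, ← Real.norm_eq_abs]
  refine (ContinuousMultilinearMap.le_opNorm _ _).trans ?_
  simp [norm_ee]

lemma pd_smooth {n : ℕ} (i : Fin n) {g : Euc n → ℝ} (hg : ContDiff ℝ ∞ g) :
    ContDiff ℝ ∞ (pd i g) := by
  have : pd i g = fun x => fderiv ℝ g x (ee i) := by
    funext x
    exact pd_of_diff i (hg.differentiable (by simp) x)
  rw [this]
  exact (hg.fderiv_right (m := ∞) (by simp)).clm_apply contDiff_const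

lemma iterD_smooth {n : ℕ} (L : List (Fin n)) {g : Euc n → ℝ} (hg : ContDiff ℝ ∞ g) :
    ContDiff ℝ ∞ (iterD L g) := by
  induction L with
  | nil => exact hg
  | cons i L ih => exact pd_smooth i ih

lemma pd_comm {n : ℕ} (i j : Fin n) {g : Euc n → ℝ} (hg : ContDiff ℝ ∞ g) :
    pd i (pd j g) = pd j (pd i g) := by
  have h (i : Fin n) : pd i g = fun x => fderiv ℝ g x (ee i) := by
    funext x
    exact pd_of_diff i (hg.differentiable (by simp) x)
  have hd : Differentiable ℝ (fderiv ℝ g) :=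
    (hg.fderiv_right (m := ∞) (by simp)).differentiable (by simp)
  have h2 (i j : Fin n) (x) : pd i (pd j g) x = fderiv ℝ (fderiv ℝ g) x (ee i) (ee j) := by
    rw [pd_of_diff i ((pd_smooth j hg).differentiable (by simp) x), h j]
    have := (hd x).hasFDerivAt.clm_apply (hasFDerivAt_const (ee j) x)
    rw [this.fderiv]
    simp
  funext x
  rw [h2, h2]
  have : IsSymmSndFDerivAt ℝ g x := (hg.contDiffAt).isSymmSndFDerivAt (by simp only [minSmoothness_of_isRCLikeNormedField]; exact (WithTop.coe_le_coe.2 (le_top : ((2:ℕ∞)) ≤ ⊤)))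
  exact this _ _

lemma iterD_perm {n : ℕ} {L L' : List (Fin n)} (h : L.Perm L') {g : Euc n → ℝ}
    (hg : ContDiff ℝ ∞ g) : iterD L g = iterD L' g := by
  induction h with
  | nil => rfl
  | cons x _ ih => simp only [iterD, ih]
  | swap x y l => simp only [iterD]; exact pd_comm _ _ (iterD_smooth l hg)
  | trans _ _ ih1 ih2 => exact ih1.trans ih2

lemma count_multiList {n : ℕ} (J : Fin n → ℕ) (i : Fin n) : (multiList n J).count i = J i := by
  unfold multiList
  rw [List.count_flatMap]
  simp only [Function.comp_def, List.count_replicate]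
  rw [← List.ofFn_eq_map, List.sum_ofFn]
  simp

lemma length_multiList {n : ℕ} (J : Fin n → ℕ) : (multiList n J).length = mdeg J := by
  unfold multiList mdeg
  rw [List.length_flatMap]
  simp [← List.ofFn_eq_map, List.sum_ofFn]

/-- Multi-index of a list. -/
def cnt {n : ℕ} (L : List (Fin n)) : Fin n → ℕ := fun i => L.count i

lemma mdeg_cnt {n : ℕ} (L : List (Fin n)) : mdeg (cnt L) = L.length := by
  unfold mdeg cnt
  induction L with
  | nil => simp
  | cons i L ih => simp [List.count_cons, Finset.sum_add_distrib, ih]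

lemma DJ_cnt {n : ℕ} (L : List (Fin n)) {g : Euc n → ℝ} (hg : ContDiff ℝ ∞ g) :
    DJ (cnt L) g = iterD L g := by
  apply iterD_perm _ hg
  rw [List.perm_iff_count]
  intro a
  rw [count_multiList]; rfl

lemma iterD_zero {n : ℕ} (L : List (Fin n)) : iterD L (fun _ : Euc n => (0:ℝ)) = fun _ => 0 := by
  induction L with
  | nil => rfl
  | cons i L ih =>
    show pd i (iterD L _) = _
    rw [ih]; funext x
    rw [pd_of_diff i (by fun_prop)]; simp

lemma iterD_add {n : ℕ} (L : List (Fin n)) {f g : Euc n → ℝ} (hf : ContDiff ℝ ∞ f)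
    (hg : ContDiff ℝ ∞ g) : iterD L (fun x => f x + g x) = fun x => iterD L f x + iterD L g x := by
  induction L with
  | nil => rfl
  | cons i L ih =>
    show pd i (iterD L _) = fun x => pd i (iterD L f) x + pd i (iterD L g) x
    rw [ih]; funext x
    have h1 := (iterD_smooth L hf).differentiable (by simp) x
    have h2 := (iterD_smooth L hg).differentiable (by simp) x
    rw [pd_of_diff i (h1.fun_add h2), pd_of_diff i h1, pd_of_diff i h2, fderiv_fun_add h1 h2]
    rfl

lemma iterD_const_mul {n : ℕ} (L : List (Fin n)) (c : ℝ) {f : Euc n → ℝ} (hf : ContDiff ℝ ∞ f) :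
    iterD L (fun x => c * f x) = fun x => c * iterD L f x := by
  induction L with
  | nil => rfl
  | cons i L ih =>
    show pd i (iterD L _) = fun x => c * pd i (iterD L f) x
    rw [ih]; funext x
    have h1 := (iterD_smooth L hf).differentiable (by simp) x
    rw [pd_of_diff i (h1.const_mul c), pd_of_diff i h1, fderiv_const_mul h1]
    rfl

lemma iterD_sum {n : ℕ} (L : List (Fin n)) {ι : Type*} (s : Finset ι) (F : ι → Euc n → ℝ)
    (hF : ∀ a ∈ s, ContDiff ℝ ∞ (F a)) :
    iterD L (fun x => ∑ a ∈ s, F a x) = fun x => ∑ a ∈ s, iterD L (F a) x := by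
  classical
  induction s using Finset.induction_on with
  | empty => simp [iterD_zero]
  | insert a s ha ih =>
    simp only [Finset.sum_insert ha]
    rw [iterD_add L (hF a (by simp)) (ContDiff.sum fun b hb => hF b (by simp [hb])),
      ih (fun b hb => hF b (by simp [hb]))]

/-! ### Derivatives of monomials -/

lemma smooth_mono {n : ℕ} (x₀ : Euc n) (I : Fin n → ℕ) :
    ContDiff ℝ ∞ (fun y => mpow (y - x₀) I) := by
  unfold mpow
  apply contDiff_prod
  intro i _
  apply ContDiff.pow
  simp only [PiLp.sub_apply]
  fun_prop

lemma pd_mono {n : ℕ} (x₀ : Euc n) (I : Fin n → ℕ) (j : Fin n) :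
    pd j (fun y => mpow (y - x₀) I) =
      fun y => (I j : ℝ) * mpow (y - x₀) (fun i => I i - if i = j then 1 else 0) := by
  funext y
  have hl : HasLineDerivAt ℝ (fun y => mpow (y - x₀) I)
      ((I j : ℝ) * mpow (y - x₀) (fun i => I i - if i = j then 1 else 0)) y
        (EuclideanSpace.single j 1) := by
    unfold HasLineDerivAt mpow
    have hs : ∀ t : ℝ, (∏ i, (y + t • EuclideanSpace.single j (1:ℝ) - x₀) i ^ I i)
        = (y j + t - x₀ j) ^ I j * ∏ i ∈ Finset.univ.erase j, (y i - x₀ i) ^ I i := by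
      intro t
      rw [← Finset.mul_prod_erase _ _ (Finset.mem_univ j)]
      congr 1
      · simp
      · apply Finset.prod_congr rfl
        intro i hi
        have : i ≠ j := Finset.ne_of_mem_erase hi
        simp [this]
    simp only [hs]
    rw [← Finset.mul_prod_erase _ _ (Finset.mem_univ j), ← mul_assoc]
    have hp : (∏ i ∈ Finset.univ.erase j, ((y - x₀) i) ^ (I i - if i = j then 1 else 0))
        = ∏ i ∈ Finset.univ.erase j, (y i - x₀ i) ^ I i := by
      apply Finset.prod_congr rfl
      intro i hi
      have : i ≠ j := Finset.ne_of_mem_erase hi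
      simp [this]
    rw [hp]
    apply HasDerivAt.mul_const
    have h0 : HasDerivAt (fun t : ℝ => y j + t - x₀ j) 1 0 := by
      simpa using ((hasDerivAt_id (0:ℝ)).const_add (y j)).sub_const (x₀ j)
    have := h0.fun_pow (I j)
    simp at this ⊢
    exact this
  exact hl.lineDeriv

lemma iterD_mono {n : ℕ} (x₀ : Euc n) (I : Fin n → ℕ) (L : List (Fin n)) :
    iterD L (fun y => mpow (y - x₀) I) =
      fun y => (∏ i, ((I i).descFactorial (cnt L i) : ℝ)) * mpow (y - x₀) (fun i => I i - cnt L i) := by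
  induction L with
  | nil => simp [iterD, cnt]
  | cons j L ih =>
    show pd j (iterD L _) = _
    rw [ih]
    have := iterD_const_mul [j] (∏ i, ((I i).descFactorial (cnt L i) : ℝ))
      (smooth_mono x₀ (fun i => I i - cnt L i))
    simp only [iterD] at this
    rw [this, pd_mono]
    funext y
    rw [← mul_assoc]
    congr 1
    · rw [← Finset.mul_prod_erase _ _ (Finset.mem_univ j),
        ← Finset.mul_prod_erase _ (fun i => ((I i).descFactorial (cnt (j :: L) i) : ℝ))
          (Finset.mem_univ j)]
      have h1 : cnt (j :: L) j = cnt L j + 1 := by simp [cnt]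
      have h2 : ∏ i ∈ Finset.univ.erase j, ((I i).descFactorial (cnt (j :: L) i) : ℝ)
          = ∏ i ∈ Finset.univ.erase j, ((I i).descFactorial (cnt L i) : ℝ) := by
        apply Finset.prod_congr rfl
        intro i hi
        have : j ≠ i := (Finset.ne_of_mem_erase hi).symm
        simp [cnt, this]
      rw [h1, h2, Nat.descFactorial_succ]
      push_cast
      ring
    · congr 1
      funext i
      by_cases h : i = j
      · subst h; simp [cnt]; omega
      · simp [cnt, h, Ne.symm h]

lemma mem_multiIdxLt {n k : ℕ} (J : Fin n → ℕ) : J ∈ multiIdxLt n k ↔ mdeg J < k := by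
  unfold multiIdxLt
  simp only [Finset.mem_filter, Fintype.mem_piFinset, Finset.mem_range, and_iff_right_iff_imp]
  intro h i
  have : J i ≤ mdeg J := Finset.single_le_sum (f := J) (fun _ _ => Nat.zero_le _) (Finset.mem_univ i)
  omega

lemma smooth_term {n : ℕ} (c : ℝ) (x₀ : Euc n) (I : Fin n → ℕ) :
    ContDiff ℝ ∞ (fun y => c * mpow (y - x₀) I / (Jfact I : ℝ)) :=
  (contDiff_const.mul (smooth_mono x₀ I)).div_const _

lemma smooth_TaylorPoly {n : ℕ} (k : ℕ) (u : Euc n → ℝ) (x₀ : Euc n) :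
    ContDiff ℝ ∞ (TaylorPoly k u x₀) := by
  unfold TaylorPoly
  exact ContDiff.sum fun I _ => smooth_term _ _ _

lemma iterD_TaylorPoly {n : ℕ} (k : ℕ) (u : Euc n → ℝ) (x₀ : Euc n) (L : List (Fin n)) (x : Euc n) :
    iterD L (TaylorPoly k u x₀) x = ∑ I ∈ multiIdxLt n k, DJ I u x₀ / (Jfact I : ℝ) *
      iterD L (fun y => mpow (y - x₀) I) x := by
  unfold TaylorPoly
  rw [iterD_sum L _ _ (fun I _ => smooth_term _ _ _)]
  apply Finset.sum_congr rfl
  intro I _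
  have : (fun y => DJ I u x₀ * mpow (y - x₀) I / (Jfact I : ℝ)) =
    fun y => (DJ I u x₀ / (Jfact I : ℝ)) * mpow (y - x₀) I := by funext y; ring
  rw [this, iterD_const_mul L _ (smooth_mono x₀ I)]

lemma iterD_mono_center {n : ℕ} (x₀ : Euc n) (I : Fin n → ℕ) (L : List (Fin n)) :
    iterD L (fun y => mpow (y - x₀) I) x₀ = if I = cnt L then (Jfact I : ℝ) else 0 := by
  rw [iterD_mono]
  split_ifs with h
  · subst h
    simp [mpow, Jfact, Nat.descFactorial_self]
  · obtain ⟨i, hi⟩ := Function.ne_iff.mp h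
    rcases lt_or_gt_of_ne hi with h1 | h1
    · apply mul_eq_zero_of_left
      apply Finset.prod_eq_zero (Finset.mem_univ i)
      simp [Nat.descFactorial_eq_zero_iff_lt.mpr h1]
    · apply mul_eq_zero_of_right
      apply Finset.prod_eq_zero (Finset.mem_univ i)
      simp; omega

lemma Jfact_ne {n : ℕ} (I : Fin n → ℕ) : (Jfact I : ℝ) ≠ 0 := by
  unfold Jfact
  exact_mod_cast Finset.prod_ne_zero_iff.mpr fun i _ => Nat.factorial_ne_zero _

lemma iterD_TaylorPoly_center {n : ℕ} (k : ℕ) {u : Euc n → ℝ} (hu : ContDiff ℝ ∞ u) (x₀ : Euc n)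
    (L : List (Fin n)) (hL : L.length < k) :
    iterD L (TaylorPoly k u x₀) x₀ = iterD L u x₀ := by
  rw [iterD_TaylorPoly]
  simp only [iterD_mono_center]
  rw [Finset.sum_eq_single (cnt L)]
  · rw [if_pos rfl, div_mul_cancel₀ _ (Jfact_ne _), DJ_cnt L hu]
  · intro I _ h; rw [if_neg h, mul_zero]
  · intro h
    exact absurd ((mem_multiIdxLt _).2 (by rw [mdeg_cnt]; exact hL)) h

lemma iterD_TaylorPoly_top {n : ℕ} (k : ℕ) (u : Euc n → ℝ) (x₀ : Euc n)
    (L : List (Fin n)) (hL : k ≤ L.length) (x : Euc n) :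
    iterD L (TaylorPoly k u x₀) x = 0 := by
  rw [iterD_TaylorPoly]
  apply Finset.sum_eq_zero
  intro I hI
  rw [mem_multiIdxLt] at hI
  apply mul_eq_zero_of_right
  rw [iterD_mono]
  apply mul_eq_zero_of_left
  have : ∃ i, I i < cnt L i := by
    by_contra! hc
    have : mdeg (cnt L) ≤ mdeg I := Finset.sum_le_sum fun i _ => hc i
    rw [mdeg_cnt] at this; omega
  obtain ⟨i, hi⟩ := this
  apply Finset.prod_eq_zero (Finset.mem_univ i)
  simp [Nat.descFactorial_eq_zero_iff_lt.mpr hi]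

/-- An iterated Fréchet derivative vanishes if all iterated partial derivatives do. -/
lemma iteratedFDeriv_eq_zero_of_iterD {n : ℕ} (m : ℕ) {g : Euc n → ℝ} (hg : ContDiff ℝ ∞ g)
    (x : Euc n) (h : ∀ L : List (Fin n), L.length = m → iterD L g x = 0) :
    iteratedFDeriv ℝ m g x = 0 := by
  apply ContinuousMultilinearMap.toMultilinearMap_injective
  apply Module.Basis.ext_multilinear
    (fun _ => (EuclideanSpace.basisFun (Fin n) ℝ).toBasis)
  intro v
  have h1 := h (List.ofFn v) (by simp)
  have hc : ContDiff ℝ ((List.ofFn v).length : ℕ) g := hg.of_le (by exact_mod_cast le_top)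
  rw [iterD_eq _ hc] at h1
  have key : ∀ (m' : ℕ) (hm : m' = m) (w : Fin m' → Euc n),
      (∀ j : Fin m', w j = ee (v (Fin.cast hm j))) → iteratedFDeriv ℝ m' g x w = 0 →
      iteratedFDeriv ℝ m g x (fun j => ee (v j)) = 0 := by
    intro m' hm w hw h0
    subst hm
    have : w = fun j => ee (v j) := funext hw
    rwa [← this]
  have := key _ (by simp) _ (by intro j; simp; rfl) h1
  simpa [ee] using this

/-! ### Taylor estimate for smooth functions -/

lemma taylor_aux {n : ℕ} (k : ℕ) (B : ℝ) {g : Euc n → ℝ} (hg : ContDiff ℝ ∞ g) (x₀ : Euc n)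
    (h0 : ∀ i < k, iteratedFDeriv ℝ i g x₀ = 0) (hk : ∀ x, ‖iteratedFDeriv ℝ k g x‖ ≤ B) :
    ∀ d ≤ k, ∀ x, ‖iteratedFDeriv ℝ (k - d) g x‖ ≤ B * ‖x - x₀‖ ^ d := by
  have hB : 0 ≤ B := (norm_nonneg _).trans (hk x₀)
  intro d
  induction d with
  | zero => intro _ x; simpa using hk x
  | succ d ih =>
    intro hd x
    have ih' := ih (by omega)
    have hi : k - d = (k - (d+1)) + 1 := by omega
    rw [hi] at ih'
    have hdiff : Differentiable ℝ (iteratedFDeriv ℝ (k - (d+1)) g) :=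
      hg.differentiable_iteratedFDeriv (WithTop.coe_lt_coe.2 (ENat.natCast_lt_top _))
    have hc : Convex ℝ (closedBall x₀ ‖x - x₀‖) := convex_closedBall _ _
    have := hc.norm_image_sub_le_of_norm_fderiv_le (f := iteratedFDeriv ℝ (k - (d+1)) g)
      (𝕜 := ℝ) (C := B * ‖x - x₀‖ ^ d) (x := x₀) (y := x) (fun z _ => hdiff z) ?_
      (by simp) (by simp [dist_eq_norm])
    · rw [h0 _ (by omega), sub_zero] at this
      rw [pow_succ, ← mul_assoc]
      exact this
    · intro z hz
      rw [norm_fderiv_iteratedFDeriv]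
      refine (ih' z).trans ?_
      have : ‖z - x₀‖ ≤ ‖x - x₀‖ := by simpa [dist_eq_norm] using hz
      gcongr

lemma taylor_est {n : ℕ} (k : ℕ) (B : ℝ) {g : Euc n → ℝ} (hg : ContDiff ℝ ∞ g) (x₀ x : Euc n)
    (hk : ∀ x, ‖iteratedFDeriv ℝ k g x‖ ≤ B) (L : List (Fin n)) (hL : L.length < k) :
    |iterD L g x - iterD L (TaylorPoly k g x₀) x| ≤ B * ‖x - x₀‖ ^ (k - L.length) := by
  set T := TaylorPoly k g x₀ with hT
  have hTs : ContDiff ℝ ∞ T := smooth_TaylorPoly k g x₀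
  have hG : ContDiff ℝ ∞ (fun x => g x + (-1) * T x) := hg.add (contDiff_const.mul hTs)
  have hsub : ∀ L : List (Fin n), ∀ x, iterD L (fun x => g x + (-1) * T x) x =
      iterD L g x - iterD L T x := by
    intro L x
    rw [iterD_add L hg (contDiff_const.mul hTs), iterD_const_mul L _ hTs]
    ring
  have hTk : ∀ x, iteratedFDeriv ℝ k T x = 0 := fun x =>
    iteratedFDeriv_eq_zero_of_iterD k hTs x fun L hL =>
      iterD_TaylorPoly_top k g x₀ L hL.ge x
  have hGk : ∀ x, ‖iteratedFDeriv ℝ k (fun x => g x + (-1) * T x) x‖ ≤ B := by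
    intro x
    have hkk : ((k:ℕ):ℕ∞ω) ≤ ∞ := by exact_mod_cast le_top
    have e : (fun x => g x + (-1) * T x) = g + (-1:ℝ) • T := by
      funext x; simp
    have hc : ContDiff ℝ (k:ℕ) ((-1:ℝ) • T) := (hTs.of_le hkk).const_smul (-1:ℝ)
    rw [e, iteratedFDeriv_add_apply (hg.of_le hkk).contDiffAt hc.contDiffAt,
      iteratedFDeriv_const_smul_apply (hTs.of_le hkk).contDiffAt, hTk]
    simpa using hk x
  have h := taylor_aux k B hG x₀ (fun i hi => iteratedFDeriv_eq_zero_of_iterD i hG x₀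
    fun L hL => by
      rw [hsub, hT, iterD_TaylorPoly_center k hg x₀ L (by omega), sub_self]) hGk
    (k - L.length) (by omega) x
  rw [← hsub]
  refine (abs_iterD_le L (hG.of_le (by exact_mod_cast le_top)) x).trans ?_
  rwa [Nat.sub_sub_self hL.le] at h

/-- Limits of smooth functions with uniformly bounded derivatives belong to `Lip`. -/
lemma memLip_of_series {n : ℕ} (k : ℕ) (B : ℝ) (v : ℕ → Euc n → ℝ)
    (hv : ∀ j, ContDiff ℝ ∞ (v j)) (b : ℕ → ℕ → ℝ)
    (hb : ∀ i < k, Summable (b i))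
    (hvb : ∀ i < k, ∀ j x, ‖iteratedFDeriv ℝ i (v j) x‖ ≤ b i j)
    (hB : ∀ i ≤ k, ∀ m x, ‖iteratedFDeriv ℝ i (fun y => ∑ j ∈ Finset.range m, v j y) x‖ ≤ B) :
    MemLip n k B (fun x => ∑' j, v j x) := by
  set u : Euc n → ℝ := fun x => ∑' j, v j x with hu
  set f : ℕ → Euc n → ℝ := fun m y => ∑ j ∈ Finset.range m, v j y with hf
  have hfs : ∀ m, ContDiff ℝ ∞ (f m) := fun m => ContDiff.sum fun j _ => hv j
  have hle : ∀ i : ℕ, ((i:ℕ):ℕ∞ω) ≤ ∞ := fun i => by exact_mod_cast le_top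
  have hus : ∀ i < k, ContDiff ℝ (i:ℕ) u := by
    intro i hi
    refine contDiff_tsum (N := (i:ℕ∞)) (v := b) (fun j => (hv j).of_le (hle i)) ?_ ?_
    · intro i' hi'; exact hb i' (by have : i' ≤ i := by exact_mod_cast hi'
                                    omega)
    · intro i' j x hi'
      exact hvb i' (by have : i' ≤ i := by exact_mod_cast hi'
                       omega) j x
  have hlim : ∀ L : List (Fin n), L.length < k → ∀ x,
      Tendsto (fun m => iterD L (f m) x) atTop (nhds (iterD L u x)) := by
    intro L hL x
    rw [iterD_eq L (hus _ hL)]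
    have h1 : iteratedFDeriv ℝ L.length u x = ∑' j, iteratedFDeriv ℝ L.length (v j) x :=
      iteratedFDeriv_tsum_apply (N := (L.length:ℕ∞)) (v := b)
        (fun j => (hv j).of_le (hle _))
        (fun i' hi' => hb i' (by have : i' ≤ L.length := by exact_mod_cast hi'
                                 omega))
        (fun i' j x hi' => hvb i' (by have : i' ≤ L.length := by exact_mod_cast hi'
                                      omega) j x) le_rfl x
    have h2 : Summable (fun j => iteratedFDeriv ℝ L.length (v j) x) :=
      Summable.of_norm_bounded (hb _ hL) (fun j => hvb _ hL j x)
    have h3 := h2.hasSum.tendsto_sum_nat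
    rw [← h1] at h3
    have h4 := ((ContinuousMultilinearMap.apply ℝ (fun _ : Fin L.length => Euc n) ℝ
          (fun j => ee (L.get j))).continuous.tendsto _).comp h3
    refine h4.congr fun m => ?_
    rw [iterD_eq L ((hfs m).of_le (hle _))]
    simp only [Function.comp]
    rw [hf, iteratedFDeriv_fun_sum_apply (fun j _ => ((hv j).of_le (hle _)).contDiffAt)]
    rfl
  refine ⟨fun J hJ => (iterD_aux _ u (hus _ (by rwa [length_multiList]))).1, ?_⟩
  intro J hJ x x₀
  have hlen : (multiList n J).length < k := by rwa [length_multiList]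
  constructor
  · refine le_of_tendsto ((hlim _ hlen x₀).abs) (Eventually.of_forall fun m => ?_)
    exact (abs_iterD_le _ ((hfs m).of_le (hle _)) x₀).trans (hB _ hlen.le m x₀)
  · have hT : Tendsto (fun m => iterD (multiList n J) (TaylorPoly k (f m) x₀) x) atTop
        (nhds (iterD (multiList n J) (TaylorPoly k u x₀) x)) := by
      simp only [iterD_TaylorPoly]
      refine tendsto_finsetSum _ fun I hI => ?_
      refine Tendsto.mul_const _ (Tendsto.div_const ?_ _)
      exact hlim _ (by rw [length_multiList]; exact (mem_multiIdxLt I).1 hI) x₀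
    refine le_of_tendsto (((hlim _ hlen x).sub hT).abs) (Eventually.of_forall fun m => ?_)
    have := taylor_est k B (hfs m) x₀ x (hB k le_rfl m) _ hlen
    rwa [length_multiList] at this

/-! ### Polynomials -/

lemma exists_bound_of_injective {V F G : Type*} [AddCommGroup V] [Module ℝ V]
    [FiniteDimensional ℝ V] [NormedAddCommGroup F] [NormedSpace ℝ F]
    [NormedAddCommGroup G] [NormedSpace ℝ G] (L : V →ₗ[ℝ] F) (hL : Function.Injective L)
    (T : V →ₗ[ℝ] G) : ∃ C : ℝ, 0 ≤ C ∧ ∀ v, ‖T v‖ ≤ C * ‖L v‖ := by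
  let e := LinearEquiv.ofInjective L hL
  have : FiniteDimensional ℝ (LinearMap.range L) := inferInstance
  let S : LinearMap.range L →ₗ[ℝ] G := T.comp e.symm.toLinearMap
  let S' := LinearMap.toContinuousLinearMap S
  refine ⟨‖S'‖, ContinuousLinearMap.opNorm_nonneg _, fun v => ?_⟩
  have h := S'.le_opNorm (e v)
  have h1 : S' (e v) = T v := by simp [S', S]
  rw [h1] at h
  exact h

/-- Evaluation of an `MvPolynomial` on Euclidean space. -/
def pev {n : ℕ} (P : MvPolynomial (Fin n) ℝ) (x : Euc n) : ℝ :=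
  MvPolynomial.eval (fun i => x i) P

/-- The finite set of exponents of degree at most `m`. -/
def expo (n m : ℕ) : Finset (Fin n →₀ ℕ) := (Finsupp.finite_of_degree_le (σ := Fin n) m).toFinset

lemma mem_expo {n m : ℕ} (d : Fin n →₀ ℕ) : d ∈ expo n m ↔ ∑ i, d i ≤ m := by
  simp [expo, Finsupp.degree_eq_sum]

lemma pev_eq {n m : ℕ} {P : MvPolynomial (Fin n) ℝ} (hP : P.totalDegree ≤ m) (x : Euc n) :
    pev P x = ∑ d ∈ expo n m, P.coeff d * mpow x d := by
  unfold pev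
  rw [MvPolynomial.eval_eq']
  apply Finset.sum_subset
  · intro d hd
    rw [mem_expo]
    have := MvPolynomial.le_totalDegree hd
    rw [Finsupp.sum_fintype _ _ (by simp)] at this
    exact this.trans hP
  · intro d _ hd
    simp [MvPolynomial.notMem_support_iff.mp hd]

lemma mpow_smooth {n : ℕ} (d : Fin n → ℕ) : ContDiff ℝ ∞ (fun x : Euc n => mpow x d) := by
  simpa using smooth_mono (0 : Euc n) d

lemma pev_smooth {n : ℕ} (P : MvPolynomial (Fin n) ℝ) : ContDiff ℝ ∞ (pev P) := by
  have : pev P = fun x => ∑ d ∈ expo n P.totalDegree, P.coeff d * mpow x d :=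
    funext fun x => pev_eq le_rfl x
  rw [this]
  exact ContDiff.sum fun d _ => contDiff_const.mul (mpow_smooth d)

lemma abs_mpow_le {n : ℕ} (d : Fin n → ℕ) (x : Euc n) : |mpow x d| ≤ ‖x‖ ^ (∑ i, d i) := by
  unfold mpow
  rw [Finset.abs_prod, ← Finset.prod_pow_eq_pow_sum]
  apply Finset.prod_le_prod (fun _ _ => abs_nonneg _)
  intro i _
  rw [abs_pow]
  gcongr
  exact PiLp.norm_apply_le x i

lemma coeff_bound (n m : ℕ) : ∃ C : ℝ, 0 < C ∧ ∀ P : MvPolynomial (Fin n) ℝ, P.totalDegree ≤ m →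
    ∀ S : ℝ, (∀ x ∈ closedBall (0 : Euc n) 1, |pev P x| ≤ S) → ∀ d, |P.coeff d| ≤ C * S := by
  let V := MvPolynomial.restrictTotalDegree (Fin n) ℝ m
  have : CompactSpace (closedBall (0 : Euc n) 1) :=
    isCompact_iff_compactSpace.mp (isCompact_closedBall _ _)
  let L : V →ₗ[ℝ] C(closedBall (0 : Euc n) 1, ℝ) :=
    { toFun := fun P => ⟨fun x => pev P.1 x, (pev_smooth P.1).continuous.comp continuous_subtype_val⟩
      map_add' := by intro P Q; ext x; simp [pev]
      map_smul' := by intro c P; ext x; simp [pev] }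
  have hL : Function.Injective L := by
    intro P Q h
    apply Subtype.ext
    apply MvPolynomial.funext_set (fun _ : Fin n => Set.Icc (0:ℝ) (1 / (n+1)))
    · intro i
      exact Set.Icc_infinite (by positivity)
    · intro x hx
      have hb : (WithLp.toLp 2 x : Euc n) ∈ closedBall (0 : Euc n) 1 := by
        simp only [mem_closedBall, dist_zero_right]
        rw [EuclideanSpace.norm_eq]
        apply Real.sqrt_le_one.mpr
        calc ∑ i, ‖x i‖ ^ 2 ≤ ∑ i : Fin n, (1 / ((n:ℝ)+1)) ^ 2 := by
              apply Finset.sum_le_sum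
              intro i _
              have := hx i (Set.mem_univ i)
              rw [Real.norm_eq_abs, abs_of_nonneg this.1]
              have h0 := this.1
              gcongr
              exact this.2
          _ = n / ((n:ℝ)+1)^2 := by simp; ring
          _ ≤ 1 := by
              rw [div_le_one (by positivity)]
              nlinarith [(Nat.cast_nonneg n : (0:ℝ) ≤ n)]
      have := congrArg (fun g => g ⟨_, hb⟩) h
      exact this
  let T : V →ₗ[ℝ] (expo n m → ℝ) :=
    { toFun := fun P d => P.1.coeff d.1
      map_add' := by intro P Q; ext d; simp
      map_smul' := by intro c P; ext d; simp }
  obtain ⟨C, hC0, hC⟩ := exists_bound_of_injective L hL T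
  refine ⟨C + 1, by positivity, fun P hP S hS d => ?_⟩
  have hS0 : 0 ≤ S := (abs_nonneg _).trans (hS 0 (by simp))
  by_cases hd : d ∈ expo n m
  · have h1 := hC ⟨P, (MvPolynomial.mem_restrictTotalDegree _ _ _).2 hP⟩
    have h2 : ‖L ⟨P, (MvPolynomial.mem_restrictTotalDegree _ _ _).2 hP⟩‖ ≤ S := by
      rw [ContinuousMap.norm_le _ hS0]
      intro x
      exact hS x x.2
    have h3 := norm_le_pi_norm (T ⟨P, (MvPolynomial.mem_restrictTotalDegree _ _ _).2 hP⟩) ⟨d, hd⟩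
    calc |P.coeff d| ≤ _ := h3
      _ ≤ _ := h1
      _ ≤ C * S := by gcongr
      _ ≤ (C+1) * S := by nlinarith
  · have : P.coeff d = 0 := by
      by_contra h
      apply hd
      rw [mem_expo]
      have := MvPolynomial.le_totalDegree (MvPolynomial.mem_support_iff.2 h)
      rw [Finsupp.sum_fintype _ _ (by simp)] at this
      exact this.trans hP
    rw [this]; simp; positivity

lemma IsPolyFun.smooth {n m : ℕ} {p : Euc n → ℝ} (hp : IsPolyFun n m p) : ContDiff ℝ ∞ p := by
  obtain ⟨P, _, h⟩ := hp
  have : p = pev P := funext h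
  rw [this]; exact pev_smooth P

lemma IsPolyFun.sub {n m : ℕ} {p q : Euc n → ℝ} (hp : IsPolyFun n m p) (hq : IsPolyFun n m q) :
    IsPolyFun n m (fun x => p x - q x) := by
  obtain ⟨P, hP, h⟩ := hp
  obtain ⟨Q, hQ, h'⟩ := hq
  exact ⟨P - Q, (MvPolynomial.totalDegree_sub P Q).trans (max_le hP hQ), fun x => by simp [h, h']⟩

lemma totalDegree_lin {n : ℕ} (c r : ℝ) (i : Fin n) :
    (MvPolynomial.C c + MvPolynomial.C r * MvPolynomial.X i : MvPolynomial (Fin n) ℝ).totalDegree ≤ 1 := by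
  refine (MvPolynomial.totalDegree_add _ _).trans (max_le (by simp) ?_)
  refine (MvPolynomial.totalDegree_mul _ _).trans ?_
  simp [MvPolynomial.totalDegree_X]

/-- Sums of products of affine coordinate functions are polynomials. -/
lemma isPolyFun_sum {n m : ℕ} {ι : Type*} (s : Finset ι) (a : ι → ℝ) (d : ι → Fin n → ℕ)
    (hd : ∀ j ∈ s, ∑ i, d j i ≤ m) (c : Fin n → ℝ) (r : ℝ) :
    IsPolyFun n m (fun x => ∑ j ∈ s, a j * ∏ i, (c i + r * x i) ^ d j i) := by
  refine ⟨∑ j ∈ s, MvPolynomial.C (a j) *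
    ∏ i, (MvPolynomial.C (c i) + MvPolynomial.C r * MvPolynomial.X i) ^ d j i, ?_, ?_⟩
  · apply MvPolynomial.totalDegree_finsetSum_le
    intro j hj
    refine (MvPolynomial.totalDegree_mul _ _).trans ?_
    simp only [MvPolynomial.totalDegree_C, zero_add]
    refine (MvPolynomial.totalDegree_finsetProd _ _).trans ?_
    refine le_trans ?_ (hd j hj)
    apply Finset.sum_le_sum
    intro i _
    refine (MvPolynomial.totalDegree_pow _ _).trans ?_
    calc _ ≤ d j i * 1 := by gcongr; exact totalDegree_lin _ _ _
      _ = _ := by simp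
  · intro x
    simp [map_sum, map_prod]

lemma IsPolyFun.affine {n m : ℕ} {p : Euc n → ℝ} (hp : IsPolyFun n m p) (y : Euc n) (r : ℝ) :
    IsPolyFun n m (fun x => p (y + r • x)) := by
  obtain ⟨P, hP, h⟩ := hp
  have e : (fun x => p (y + r • x)) = fun x => ∑ d ∈ expo n m, P.coeff d *
      ∏ i, (y i + r * x i) ^ d i := by
    funext x
    rw [h]
    have := pev_eq hP (y + r • x)
    unfold pev at this
    rw [this]
    simp [mpow]
  rw [e]
  exact isPolyFun_sum _ _ _ (fun d hd => (mem_expo d).1 hd) _ _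

/-- Normalised growth / derivative / Lipschitz bounds. -/
lemma poly_unit (n m k : ℕ) : ∃ C : ℝ, 1 ≤ C ∧ ∀ p : Euc n → ℝ, IsPolyFun n m p →
    ∀ S : ℝ, (∀ x ∈ closedBall (0 : Euc n) 1, |p x| ≤ S) →
      (∀ x, |p x| ≤ C * S * (max 1 ‖x‖) ^ m) ∧
      (∀ i ≤ k, ‖iteratedFDeriv ℝ i p 0‖ ≤ C * S) ∧
      (∀ x ∈ closedBall (0 : Euc n) 1, ∀ y ∈ closedBall (0 : Euc n) 1,
        |p x - p y| ≤ C * S * ‖x - y‖) := by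
  obtain ⟨C, hC0, hC⟩ := coeff_bound n m
  have hlip : ∀ d : Fin n →₀ ℕ, ∃ K : ℝ, 0 ≤ K ∧ ∀ x ∈ closedBall (0 : Euc n) 1,
      ∀ y ∈ closedBall (0 : Euc n) 1, |mpow x d - mpow y d| ≤ K * ‖x - y‖ := by
    intro d
    have hs := mpow_smooth (n := n) d
    have hcont : Continuous (fun x => ‖fderiv ℝ (fun x : Euc n => mpow x d) x‖) :=
      (hs.continuous_fderiv (by simp)).norm
    obtain ⟨K, hK⟩ := (isCompact_closedBall (0 : Euc n) 1).bddAbove_image hcont.continuousOn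
    have hK' : ∀ x ∈ closedBall (0 : Euc n) 1, ‖fderiv ℝ (fun x : Euc n => mpow x d) x‖ ≤ K :=
      fun x hx => hK (Set.mem_image_of_mem _ hx)
    refine ⟨K, (norm_nonneg _).trans (hK' 0 (by simp)), fun x hx y hy => ?_⟩
    exact (convex_closedBall (0 : Euc n) 1).norm_image_sub_le_of_norm_fderiv_le (𝕜 := ℝ)
      (f := fun x : Euc n => mpow x d)
      (fun z _ => hs.differentiable (by simp) z) hK' hy hx
  choose K hK0 hK using hlip
  set A : ℝ := ∑ d ∈ expo n m, C * (1 + K d + ∑ i ∈ Finset.range (k+1),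
      ‖iteratedFDeriv ℝ i (fun x : Euc n => mpow x d) 0‖) with hA
  have hpos : ∀ d : Fin n →₀ ℕ, 0 ≤ ∑ i ∈ Finset.range (k+1),
      ‖iteratedFDeriv ℝ i (fun x : Euc n => mpow x d) 0‖ :=
    fun d => Finset.sum_nonneg fun i _ => norm_nonneg _
  refine ⟨max 1 A, le_max_left _ _, ?_⟩
  intro p hp S hS
  have hS0 : 0 ≤ S := (abs_nonneg _).trans (hS 0 (by simp))
  obtain ⟨P, hP, h⟩ := hp
  have hp : p = pev P := funext h
  have hc := hC P hP S (by intro x hx; rw [← hp]; exact hS x hx)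
  have hpe : p = fun x => ∑ d ∈ expo n m, P.coeff d * mpow x d := by
    rw [hp]; funext x; exact pev_eq hP x
  have hAS : A * S = ∑ d ∈ expo n m, (C * S) * (1 + K d + ∑ i ∈ Finset.range (k+1),
      ‖iteratedFDeriv ℝ i (fun x : Euc n => mpow x d) 0‖) := by
    rw [hA, Finset.sum_mul]
    exact Finset.sum_congr rfl fun d _ => by ring
  have hAle : A * S ≤ max 1 A * S := by gcongr; exact le_max_right _ _
  have hCS : 0 ≤ C * S := by positivity
  refine ⟨fun x => ?_, fun i hi => ?_, fun x hx y hy => ?_⟩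
  · refine le_trans ?_ (mul_le_mul_of_nonneg_right hAle (by positivity))
    rw [hAS, hpe, Finset.sum_mul]
    refine (Finset.abs_sum_le_sum_abs _ _).trans (Finset.sum_le_sum fun d hd => ?_)
    rw [abs_mul]
    have h1 : |mpow x d| ≤ (max 1 ‖x‖) ^ m := by
      refine (abs_mpow_le _ x).trans ?_
      calc ‖x‖ ^ (∑ i, d i) ≤ (max 1 ‖x‖) ^ (∑ i, d i) := by
            gcongr; exact le_max_right _ _
        _ ≤ _ := pow_le_pow_right₀ (le_max_left _ _) ((mem_expo d).1 hd)
    refine mul_le_mul ?_ h1 (abs_nonneg _) ?_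
    · refine (hc d).trans (le_mul_of_one_le_right hCS ?_)
      linarith [hK0 d, hpos d]
    · exact mul_nonneg hCS (by linarith [hK0 d, hpos d])
  · refine le_trans ?_ hAle
    rw [hAS, hpe]
    have hci : ∀ d ∈ expo n m, ContDiffAt ℝ (i:ℕ) (fun x : Euc n => P.coeff d * mpow x d) 0 := by
      intro d _
      exact ((contDiff_const.mul (mpow_smooth d)).of_le (by exact_mod_cast le_top)).contDiffAt
    rw [iteratedFDeriv_fun_sum_apply hci]
    refine (norm_sum_le _ _).trans (Finset.sum_le_sum fun d hd => ?_)
    have e : (fun x : Euc n => P.coeff d * mpow x d) = (P.coeff d) • (fun x : Euc n => mpow x d) := by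
      funext x; simp
    rw [e, iteratedFDeriv_const_smul_apply
      ((mpow_smooth d).of_le (by exact_mod_cast le_top)).contDiffAt, norm_smul]
    refine mul_le_mul (hc d) ?_ (norm_nonneg _) hCS
    have := Finset.single_le_sum (f := fun i => ‖iteratedFDeriv ℝ i (fun x : Euc n => mpow x d) 0‖)
      (fun i _ => norm_nonneg _) (Finset.mem_range.2 (Nat.lt_succ_of_le hi))
    linarith [hK0 d, this]
  · refine le_trans ?_ (mul_le_mul_of_nonneg_right hAle (norm_nonneg _))
    rw [hAS, hpe, Finset.sum_mul, ← Finset.sum_sub_distrib]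
    refine (Finset.abs_sum_le_sum_abs _ _).trans (Finset.sum_le_sum fun d hd => ?_)
    rw [← mul_sub, abs_mul, mul_assoc]
    refine mul_le_mul (hc d) ((hK d x hx y hy).trans ?_) (abs_nonneg _) hCS
    gcongr
    linarith [hpos d]

/-- Markov inequality for polynomials. -/
lemma poly_markov (n m k : ℕ) : ∃ C : ℝ, 1 ≤ C ∧ ∀ p : Euc n → ℝ, IsPolyFun n m p →
    ∀ (x : Euc n) (r S : ℝ), 0 < r → (∀ z ∈ closedBall x r, |p z| ≤ S) →
      ∀ i ≤ k, r ^ i * ‖iteratedFDeriv ℝ i p x‖ ≤ C * S := by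
  obtain ⟨C, hC1, hC⟩ := poly_unit n m k
  refine ⟨C, hC1, fun p hp x r S hr hS i hi => ?_⟩
  have h := (hC _ (hp.affine x r) S ?_).2.1 i hi
  · have hsm : ContDiff ℝ (i:ℕ) (fun z => p (x + z)) :=
      (hp.smooth.comp (contDiff_const.add contDiff_id)).of_le (by exact_mod_cast le_top)
    have := congrFun (iteratedFDeriv_comp_const_smul r hsm) 0
    rw [this, norm_smul, smul_zero, iteratedFDeriv_comp_add_left, add_zero, norm_pow,
      Real.norm_eq_abs, abs_of_pos hr] at h
    exact h
  · intro z hz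
    apply hS
    simp only [mem_closedBall, dist_zero_right] at hz
    simp only [mem_closedBall, dist_eq_norm, add_sub_cancel_left, norm_smul, Real.norm_eq_abs,
      abs_of_pos hr]
    nlinarith

/-- De Giorgi type lemma with growth. -/
lemma poly_degiorgi (n m : ℕ) : ∃ η C : ℝ, 0 < η ∧ 1 ≤ C ∧ ∀ p : Euc n → ℝ, IsPolyFun n m p →
    ∀ (y : Euc n) (r A : ℝ), 0 < r →
      volume {z | z ∈ ball y r ∧ A < |p z|} ≤ ENNReal.ofReal η * volume (ball y r) →
      ∀ z, |p z| ≤ C * A * (max 1 (‖z - y‖ / r)) ^ m := by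
  obtain ⟨C, hC1, hC⟩ := poly_unit n m 0
  set ρ : ℝ := 1 / (2 * C) with hρ
  have hρ0 : 0 < ρ := by positivity
  have hρ1 : ρ ≤ 1 / 2 := by
    rw [hρ]; apply one_div_le_one_div_of_le <;> linarith
  refine ⟨(ρ/2)^n / 2, 2 * C, by positivity, by linarith, ?_⟩
  intro p hp y r A hr hvol z
  set q : Euc n → ℝ := fun x => p (y + r • x) with hq
  have hqp : IsPolyFun n m q := hp.affine y r
  obtain ⟨a, ha, hmax⟩ := (isCompact_closedBall (0 : Euc n) 1).exists_isMaxOn ⟨0, by simp⟩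
    (hqp.smooth.continuous.abs.continuousOn)
  set S := |q a| with hS
  have hmax' : ∀ x ∈ closedBall (0 : Euc n) 1, |q x| ≤ S := fun x hx => hmax hx
  obtain ⟨h1, -, h3⟩ := hC q hqp S hmax'
  have ha' : ‖a‖ ≤ 1 := by simpa using ha
  -- a good point
  set b : Euc n := y + r • ((1 - ρ/2) • a) with hb
  have hsub : ball b (r * (ρ/2)) ⊆ ball y r := by
    apply ball_subset_ball'
    rw [hb, dist_eq_norm, add_sub_cancel_left, norm_smul, norm_smul, Real.norm_eq_abs,
      Real.norm_eq_abs, abs_of_pos hr, abs_of_nonneg (by linarith)]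
    have : (1 - ρ/2) * ‖a‖ ≤ 1 - ρ/2 := by nlinarith
    nlinarith
  have hex : ∃ w ∈ ball b (r * (ρ/2)), |p w| ≤ A := by
    by_contra! hcon
    have hsub2 : ball b (r * (ρ/2)) ⊆ {z | z ∈ ball y r ∧ A < |p z|} :=
      fun w hw => ⟨hsub hw, hcon w hw⟩
    have hle := (measure_mono hsub2).trans hvol
    have hv : volume (ball b (r * (ρ/2))) = ENNReal.ofReal ((ρ/2)^n) * volume (ball y r) := by
      rw [Measure.addHaar_ball_of_pos volume b (by positivity : 0 < r * (ρ/2)),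
        Measure.addHaar_ball_of_pos volume y hr]
      simp only [finrank_euclideanSpace, Fintype.card_fin]
      rw [← mul_assoc, ← ENNReal.ofReal_mul (by positivity), mul_pow, mul_comm (r^n)]
    rw [hv] at hle
    have hb0 : volume (ball y r) ≠ 0 := (measure_ball_pos volume y hr).ne'
    have hbt : volume (ball y r) ≠ ⊤ := measure_ball_lt_top.ne
    rw [ENNReal.mul_le_mul_iff_left hb0 hbt, ENNReal.ofReal_le_ofReal_iff (by positivity)] at hle
    have : 0 < (ρ/2)^n := by positivity
    linarith
  obtain ⟨w, hw, hwA⟩ := hex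
  -- rescale w
  set w' : Euc n := r⁻¹ • (w - y) with hw'
  have hww : w = y + r • w' := by rw [hw', smul_smul, mul_inv_cancel₀ hr.ne', one_smul]; abel
  have hqw : |q w'| ≤ A := by rw [hq]; simp only; rw [← hww]; exact hwA
  have hd : ‖w' - (1 - ρ/2) • a‖ ≤ ρ/2 := by
    have : w - b = r • (w' - (1 - ρ/2) • a) := by rw [hb, hww, smul_sub]; abel
    have h4 : ‖w - b‖ < r * (ρ/2) := by simpa [dist_eq_norm] using hw
    rw [this, norm_smul, Real.norm_eq_abs, abs_of_pos hr] at h4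
    exact (lt_of_mul_lt_mul_left h4 hr.le).le
  have hwb : w' ∈ closedBall (0 : Euc n) 1 := by
    simp only [mem_closedBall, dist_zero_right]
    calc ‖w'‖ = ‖(w' - (1 - ρ/2) • a) + (1 - ρ/2) • a‖ := by simp
      _ ≤ ρ/2 + ‖(1 - ρ/2) • a‖ := (norm_add_le _ _).trans (by gcongr)
      _ ≤ ρ/2 + (1 - ρ/2) := by
          gcongr; rw [norm_smul, Real.norm_eq_abs, abs_of_nonneg (by linarith)]; nlinarith
      _ = 1 := by ring
  have hwa : ‖a - w'‖ ≤ ρ := by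
    calc ‖a - w'‖ = ‖(ρ/2) • a - (w' - (1 - ρ/2) • a)‖ := by
          congr 1; module
      _ ≤ ‖(ρ/2) • a‖ + ρ/2 := (norm_sub_le _ _).trans (by gcongr)
      _ ≤ ρ/2 + ρ/2 := by
          gcongr; rw [norm_smul, Real.norm_eq_abs, abs_of_nonneg (by positivity)]; nlinarith
      _ = ρ := by ring
  have hS0 : 0 ≤ S := abs_nonneg _
  have hSA : S ≤ 2 * A := by
    have h5 := h3 a ha w' hwb
    have h6 : C * S * ‖a - w'‖ ≤ C * S * ρ := by gcongr
    have h7 : C * S * ρ = S / 2 := by rw [hρ]; field_simp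
    have h8 : |q a| - |q w'| ≤ |q a - q w'| := abs_sub_abs_le_abs_sub _ _
    rw [← hS] at h8
    linarith
  have h9 := h1 (r⁻¹ • (z - y))
  have h10 : q (r⁻¹ • (z - y)) = p z := by
    rw [hq]; simp only; rw [smul_smul, mul_inv_cancel₀ hr.ne', one_smul]; congr 1; abel
  rw [h10, norm_smul, norm_inv, Real.norm_eq_abs, abs_of_pos hr, inv_mul_eq_div] at h9
  refine h9.trans ?_
  have : C * S ≤ 2 * C * A := by nlinarith
  gcongr

/-- Weighted bound on the derivatives up to order `k` at the point `x`, at scale `t`. -/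
def WB {n : ℕ} (k : ℕ) (t : ℝ) (g : Euc n → ℝ) (x : Euc n) (A : ℝ) : Prop :=
  ∀ i ≤ k, t ^ i * ‖iteratedFDeriv ℝ i g x‖ ≤ A

lemma nat_le_infty (i : ℕ) : ((i : ℕ) : WithTop ℕ∞) ≤ ∞ := by exact_mod_cast le_top

lemma WB.congr {n k : ℕ} {t A : ℝ} {f g : Euc n → ℝ} {x : Euc n} (hf : WB k t f x A)
    (h : f =ᶠ[nhds x] g) : WB k t g x A := by
  intro i hi
  rw [← (h.iteratedFDeriv ℝ i).eq_of_nhds]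
  exact hf i hi

lemma WB.mono {n k : ℕ} {t A B : ℝ} {f : Euc n → ℝ} {x : Euc n} (hf : WB k t f x A)
    (h : A ≤ B) : WB k t f x B := fun i hi => (hf i hi).trans h

lemma WB.nonneg {n k : ℕ} {t A : ℝ} {f : Euc n → ℝ} {x : Euc n} (hf : WB k t f x A) : 0 ≤ A := by
  have := hf 0 (Nat.zero_le _)
  simp only [pow_zero, one_mul] at this
  exact (norm_nonneg _).trans this

lemma WB.abs_le {n k : ℕ} {t A : ℝ} {f : Euc n → ℝ} {x : Euc n} (hf : WB k t f x A) :
    |f x| ≤ A := by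
  have := hf 0 (Nat.zero_le _)
  simpa using this

lemma WB.add {n k : ℕ} {t A B : ℝ} {f g : Euc n → ℝ} {x : Euc n} (ht : 0 ≤ t)
    (sf : ContDiff ℝ ∞ f) (sg : ContDiff ℝ ∞ g)
    (hf : WB k t f x A) (hg : WB k t g x B) : WB k t (fun y => f y + g y) x (A + B) := by
  intro i hi
  have e : iteratedFDeriv ℝ i (fun y => f y + g y) x
      = iteratedFDeriv ℝ i f x + iteratedFDeriv ℝ i g x :=
    iteratedFDeriv_add_apply ((sf.of_le (nat_le_infty i)).contDiffAt)
      ((sg.of_le (nat_le_infty i)).contDiffAt)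
  rw [e]
  calc _ ≤ t ^ i * (‖iteratedFDeriv ℝ i f x‖ + ‖iteratedFDeriv ℝ i g x‖) := by
        gcongr; exact norm_add_le _ _
    _ ≤ _ := by rw [mul_add]; exact add_le_add (hf i hi) (hg i hi)

lemma WB.mul {n k : ℕ} {t A B : ℝ} {f g : Euc n → ℝ} {x : Euc n} (ht : 0 ≤ t)
    (sf : ContDiff ℝ ∞ f) (sg : ContDiff ℝ ∞ g)
    (hf : WB k t f x A) (hg : WB k t g x B) :
    WB k t (fun y => f y * g y) x (2 ^ k * (A * B)) := by
  intro i hi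
  have hA := hf.nonneg
  have hB := hg.nonneg
  have e := norm_iteratedFDeriv_mul_le (𝕜 := ℝ) sf sg x (nat_le_infty i)
  calc _ ≤ t ^ i * ∑ j ∈ Finset.range (i+1), (i.choose j : ℝ) * ‖iteratedFDeriv ℝ j f x‖ *
        ‖iteratedFDeriv ℝ (i-j) g x‖ := by gcongr
    _ = ∑ j ∈ Finset.range (i+1), (i.choose j : ℝ) * ((t ^ j * ‖iteratedFDeriv ℝ j f x‖) *
        (t ^ (i-j) * ‖iteratedFDeriv ℝ (i-j) g x‖)) := by
        rw [Finset.mul_sum]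
        apply Finset.sum_congr rfl
        intro j hj
        have : j + (i - j) = i := by have := Finset.mem_range.1 hj; omega
        rw [← congrArg (fun a => t ^ a) this]
        simp only [pow_add]
        ring
    _ ≤ ∑ j ∈ Finset.range (i+1), (i.choose j : ℝ) * (A * B) := by
        apply Finset.sum_le_sum
        intro j hj
        have h1 := hf j (by have := Finset.mem_range.1 hj; omega)
        have h2 := hg (i-j) (by omega)
        gcongr
    _ = 2 ^ i * (A * B) := by
        rw [← Finset.sum_mul]
        congr 1
        exact_mod_cast Nat.sum_range_choose i
    _ ≤ _ := by
        gcongr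
        norm_num

lemma WB.exists {n : ℕ} (k : ℕ) {t : ℝ} (ht : 0 ≤ t) (f : Euc n → ℝ) (x : Euc n) :
    ∃ A, WB k t f x A :=
  ⟨∑ i ∈ Finset.range (k+1), t ^ i * ‖iteratedFDeriv ℝ i f x‖, fun i hi =>
    Finset.single_le_sum (f := fun i => t ^ i * ‖iteratedFDeriv ℝ i f x‖)
      (fun j _ => by positivity) (Finset.mem_range.2 (by omega))⟩

lemma WB.zero_mul {n k : ℕ} {t : ℝ} {f g : Euc n → ℝ} {x : Euc n} (ht : 0 ≤ t)
    (sf : ContDiff ℝ ∞ f) (sg : ContDiff ℝ ∞ g)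
    (hf : WB k t f x 0) : WB k t (fun y => f y * g y) x 0 := by
  obtain ⟨B, hB⟩ := WB.exists k ht g x
  exact (hf.mul ht sf sg hB).mono (by simp)

lemma WB.sum {n k : ℕ} {ι : Type*} {t : ℝ} {x : Euc n} (ht : 0 ≤ t) (s : Finset ι)
    {f : ι → Euc n → ℝ} {A : ι → ℝ} (sf : ∀ l, ContDiff ℝ ∞ (f l))
    (hf : ∀ l ∈ s, WB k t (f l) x (A l)) : WB k t (fun y => ∑ l ∈ s, f l y) x (∑ l ∈ s, A l) := by
  intro i hi
  have e : iteratedFDeriv ℝ i (fun y => ∑ l ∈ s, f l y) x = ∑ l ∈ s, iteratedFDeriv ℝ i (f l) x :=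
    iteratedFDeriv_fun_sum_apply (fun l _ => ((sf l).of_le (nat_le_infty i)).contDiffAt)
  rw [e]
  calc _ ≤ t ^ i * ∑ l ∈ s, ‖iteratedFDeriv ℝ i (f l) x‖ := by
        gcongr; exact norm_sum_le _ _
    _ ≤ _ := by rw [Finset.mul_sum]; exact Finset.sum_le_sum fun l hl => hf l hl i hi

lemma WB.scale {n k : ℕ} {t s A c : ℝ} {f : Euc n → ℝ} {x : Euc n} (hc : 1 ≤ c) (hs : 0 ≤ s)
    (ht : 0 ≤ t) (hst : s ≤ c * t) (hf : WB k t f x A) : WB k s f x (c ^ k * A) := by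
  intro i hi
  have hA := hf.nonneg
  calc _ ≤ (c * t) ^ i * ‖iteratedFDeriv ℝ i f x‖ := by gcongr
    _ = c ^ i * (t ^ i * ‖iteratedFDeriv ℝ i f x‖) := by rw [mul_pow]; ring
    _ ≤ c ^ i * A := by gcongr; exact hf i hi
    _ ≤ _ := by gcongr

lemma WB.const {n k : ℕ} {t : ℝ} (c : ℝ) (x : Euc n) : WB k t (fun _ => c) x |c| := by
  intro i hi
  rcases Nat.eq_zero_or_pos i with h | h
  · subst h; simp
  · have : iteratedFDeriv ℝ i (fun _ : Euc n => c) x = 0 := by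
      rw [iteratedFDeriv_const_of_ne (by omega)]; rfl
    rw [this]; simp

/-- One dimensional bump function. -/
def hb (s : ℝ) : ℝ := Real.smoothTransition (s + 1) - Real.smoothTransition s

lemma hb_smooth : ContDiff ℝ ∞ hb := by
  unfold hb
  exact (Real.smoothTransition.contDiff.comp (contDiff_id.add contDiff_const)).sub
    Real.smoothTransition.contDiff

lemma hb_zero {s : ℝ} (h : 1 ≤ |s|) : hb s = 0 := by
  unfold hb
  rcases le_abs.1 h with h | h
  · rw [Real.smoothTransition.one_of_one_le (by linarith), Real.smoothTransition.one_of_one_le h]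
    simp
  · rw [Real.smoothTransition.zero_of_nonpos (by linarith),
      Real.smoothTransition.zero_of_nonpos (by linarith)]
    simp

lemma hb_sum (s : ℝ) : hb (s - ⌊s⌋) + hb (s - (⌊s⌋ + 1 : ℤ)) = 1 := by
  unfold hb
  have h1 := Int.floor_le s
  have h2 := Int.lt_floor_add_one s
  push_cast
  rw [Real.smoothTransition.one_of_one_le (x := s - ⌊s⌋ + 1) (by linarith),
    Real.smoothTransition.zero_of_nonpos (x := s - (⌊s⌋ + 1)) (by linarith)]
  ring_nf

/-- Product bump. -/
def psi {n : ℕ} (x : Euc n) : ℝ := ∏ i, hb (x i)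

lemma psi_smooth {n : ℕ} : ContDiff ℝ ∞ (psi : Euc n → ℝ) := by
  unfold psi
  apply contDiff_prod
  intro i _
  exact hb_smooth.comp (by fun_prop)

lemma psi_compact {n : ℕ} : HasCompactSupport (psi : Euc n → ℝ) := by
  apply HasCompactSupport.of_support_subset_isCompact
    (isCompact_closedBall (0 : Euc n) (Real.sqrt n))
  intro x hx
  rw [mem_closedBall_zero_iff, EuclideanSpace.norm_eq]
  apply Real.sqrt_le_sqrt
  have : ∀ i, ‖x i‖ ^ 2 ≤ 1 := by
    intro i
    by_contra h
    apply hx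
    apply Finset.prod_eq_zero (Finset.mem_univ i)
    apply hb_zero
    by_contra h'
    apply h
    rw [Real.norm_eq_abs]
    push Not at h'
    have := abs_nonneg (x i)
    nlinarith
  calc _ ≤ ∑ i : Fin n, (1:ℝ) := Finset.sum_le_sum fun i _ => this i
    _ = _ := by simp

lemma psi_bound (n k : ℕ) : ∃ C : ℝ, 1 ≤ C ∧ ∀ x : Euc n, ∀ i ≤ k, ‖iteratedFDeriv ℝ i psi x‖ ≤ C := by
  have h : ∀ i : ℕ, ∃ C : ℝ, ∀ x : Euc n, ‖iteratedFDeriv ℝ i psi x‖ ≤ C := by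
    intro i
    apply Continuous.bounded_above_of_compact_support
    · exact psi_smooth.continuous_iteratedFDeriv (nat_le_infty i)
    · exact psi_compact.iteratedFDeriv i
  choose C hC using h
  have h0 : ∀ i, 0 ≤ C i := fun i => (norm_nonneg _).trans (hC i 0)
  refine ⟨1 + ∑ i ∈ Finset.range (k+1), C i, ?_, ?_⟩
  · have := Finset.sum_nonneg (fun i (_ : i ∈ Finset.range (k+1)) => h0 i)
    linarith
  · intro x i hi
    have := Finset.single_le_sum (fun i _ => h0 i) (Finset.mem_range.2 (by omega : i < k + 1))
    linarith [hC i x]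

/-- Lattice points as vectors. -/
def lv {n : ℕ} (l : Fin n → ℤ) : Euc n := WithLp.toLp 2 (fun i => (l i : ℝ))

/-- The lattice bump. -/
def psl {n : ℕ} (t : ℝ) (l : Fin n → ℤ) (x : Euc n) : ℝ := psi (t⁻¹ • x - lv l)

lemma psl_smooth {n : ℕ} (t : ℝ) (l : Fin n → ℤ) : ContDiff ℝ ∞ (psl t l) :=
  psi_smooth.comp ((contDiff_const_smul _).sub contDiff_const)

lemma psl_eq {n : ℕ} (t : ℝ) (l : Fin n → ℤ) (x : Euc n) :
    psl t l x = ∏ i, hb (t⁻¹ * x i - l i) := by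
  unfold psl psi lv
  simp

lemma psl_WB (n k : ℕ) : ∃ C : ℝ, 1 ≤ C ∧ ∀ t : ℝ, 0 < t → ∀ (l : Fin n → ℤ) (x : Euc n),
    WB k t (psl t l) x C := by
  obtain ⟨C, h1, hC⟩ := psi_bound n k
  refine ⟨C, h1, fun t ht l x i hi => ?_⟩
  have sg : ContDiff ℝ i (fun y : Euc n => psi (y - lv l)) :=
    (psi_smooth.comp (contDiff_id.sub contDiff_const)).of_le (nat_le_infty i)
  have e := congrFun (iteratedFDeriv_comp_const_smul t⁻¹ sg) x
  have e' : psl t l = fun x => (fun y : Euc n => psi (y - lv l)) (t⁻¹ • x) := rfl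
  rw [e', e, iteratedFDeriv_comp_sub, norm_smul, norm_pow, norm_inv, Real.norm_of_nonneg ht.le,
    ← mul_assoc, inv_pow, mul_inv_cancel₀ (by positivity), one_mul]
  exact hC _ i hi

lemma norm_sub_lv {n : ℕ} {t : ℝ} (ht : 0 < t) {l : Fin n → ℤ} {x : Euc n}
    (h : ∀ i, |t⁻¹ * x i - l i| ≤ 1) : ‖x - t • lv l‖ ≤ Real.sqrt n * t := by
  have e : x - t • lv l = t • (t⁻¹ • x - lv l) := by
    rw [smul_sub, smul_smul, mul_inv_cancel₀ ht.ne', one_smul]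
  rw [e, norm_smul, Real.norm_of_nonneg ht.le, mul_comm]
  gcongr
  rw [EuclideanSpace.norm_eq]
  apply Real.sqrt_le_sqrt
  calc _ ≤ ∑ i : Fin n, (1:ℝ) := by
        apply Finset.sum_le_sum
        intro i _
        have := h i
        have h0 := abs_nonneg (t⁻¹ * x i - l i)
        have : ‖(t⁻¹ • x - lv l) i‖ = |t⁻¹ * x i - l i| := by simp [lv, Real.norm_eq_abs]
        rw [this]; nlinarith
    _ = _ := by simp

lemma psl_ne_zero {n : ℕ} {t : ℝ} (ht : 0 < t) {l : Fin n → ℤ} {x : Euc n}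
    (h : psl t l x ≠ 0) : ‖x - t • lv l‖ ≤ Real.sqrt n * t := by
  apply norm_sub_lv ht
  intro i
  by_contra hi
  apply h
  rw [psl_eq]
  exact Finset.prod_eq_zero (Finset.mem_univ i) (hb_zero (by push Not at hi; exact hi.le))

lemma psl_sum_pi {n : ℕ} (t : ℝ) (x : Euc n) :
    ∑ l ∈ Fintype.piFinset (fun i => ({⌊t⁻¹ * x i⌋, ⌊t⁻¹ * x i⌋ + 1} : Finset ℤ)), psl t l x = 1 := by
  simp_rw [psl_eq]
  rw [← Finset.prod_univ_sum (fun i => ({⌊t⁻¹ * x i⌋, ⌊t⁻¹ * x i⌋ + 1} : Finset ℤ))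
    (fun i m => hb (t⁻¹ * x i - m))]
  apply Finset.prod_eq_one
  intro i _
  rw [Finset.sum_pair (by omega)]
  exact hb_sum _

lemma psl_sum {n : ℕ} {t : ℝ} (x : Euc n) (A : Finset (Fin n → ℤ))
    (hA : ∀ l, psl t l x ≠ 0 → l ∈ A) : ∑ l ∈ A, psl t l x = 1 := by
  classical
  rw [← psl_sum_pi t x]
  set B := Fintype.piFinset (fun i => ({⌊t⁻¹ * x i⌋, ⌊t⁻¹ * x i⌋ + 1} : Finset ℤ)) with hB
  have h1 : ∑ l ∈ A, psl t l x = ∑ l ∈ A ∪ B, psl t l x := by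
    apply Finset.sum_subset Finset.subset_union_left
    intro l _ hl
    by_contra h
    exact hl (hA l h)
  rw [h1]
  symm
  apply Finset.sum_subset Finset.subset_union_right
  intro l _ hl
  rw [hB, Fintype.mem_piFinset] at hl
  push Not at hl
  obtain ⟨i, hi⟩ := hl
  simp only [Finset.mem_insert, Finset.mem_singleton, not_or] at hi
  simp only [psl_eq]
  refine Finset.prod_eq_zero (Finset.mem_univ i) (hb_zero ?_)
  by_contra h
  push Not at h
  rw [abs_lt] at h
  have h1 := Int.floor_le (t⁻¹ * x i)
  have h2 := Int.lt_floor_add_one (t⁻¹ * x i)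
  have h3 : ((⌊t⁻¹ * x i⌋ - 1 : ℤ) : ℝ) < (l i : ℝ) := by push_cast; linarith
  have h4 : (l i : ℝ) < ((⌊t⁻¹ * x i⌋ + 2 : ℤ) : ℝ) := by push_cast; linarith
  have h3' := Int.cast_lt.1 h3
  have h4' := Int.cast_lt.1 h4
  omega

lemma psl_sum_near {n : ℕ} {t : ℝ} (ht : 0 < t) (x : Euc n) (A : Finset (Fin n → ℤ))
    (hA : ∀ l, ‖x - t • lv l‖ ≤ (Real.sqrt n + 1) * t → l ∈ A) :
    (fun y => ∑ l ∈ A, psl t l y) =ᶠ[nhds x] fun _ => 1 := by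
  filter_upwards [ball_mem_nhds x ht] with y hy
  apply psl_sum
  intro l hl
  apply hA
  have h1 := psl_ne_zero ht hl
  rw [mem_ball, dist_comm, dist_eq_norm] at hy
  calc ‖x - t • lv l‖ = ‖(x - y) + (y - t • lv l)‖ := by congr 1; abel
    _ ≤ _ := norm_add_le _ _
    _ ≤ _ := by linarith

lemma lattice_WB (n k : ℕ) : ∃ C : ℝ, 1 ≤ C ∧ ∀ t : ℝ, 0 < t → ∀ (x : Euc n)
    (A : Finset (Fin n → ℤ)) (q : (Fin n → ℤ) → Euc n → ℝ) (B : ℝ), 0 ≤ B →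
    (∀ l, ContDiff ℝ ∞ (q l)) →
    (∀ l ∈ A, ‖x - t • lv l‖ ≤ (Real.sqrt n + 1) * t → WB k t (q l) x B) →
    WB k t (fun y => ∑ l ∈ A, psl t l y * q l y) x (C * B) := by
  classical
  obtain ⟨C, h1, hC⟩ := psl_WB n k
  refine ⟨3 ^ n * (2 ^ k * C), ?_, fun t ht x A q B hB sq hq => ?_⟩
  · have a1 : (1:ℝ) ≤ 3 ^ n := one_le_pow₀ (by norm_num)
    have a2 : (1:ℝ) ≤ 2 ^ k := one_le_pow₀ (by norm_num)
    exact one_le_mul_of_one_le_of_one_le a1 (one_le_mul_of_one_le_of_one_le a2 h1)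
  set Q : Finset (Fin n → ℤ) :=
    Fintype.piFinset (fun i => Finset.Icc (⌊t⁻¹ * x i⌋ - 1) (⌊t⁻¹ * x i⌋ + 1)) with hQ
  have key : ∀ l ∈ A, WB k t (fun y => psl t l y * q l y) x
      (if l ∈ Q then 2 ^ k * (C * B) else 0) := by
    intro l hl
    by_cases hx : ∀ i, |t⁻¹ * x i - l i| ≤ 1
    · have hlQ : l ∈ Q := by
        rw [hQ, Fintype.mem_piFinset]
        intro i
        have := abs_le.1 (hx i)
        rw [Finset.mem_Icc]
        have h1 := Int.floor_le (t⁻¹ * x i)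
        have h2 := Int.lt_floor_add_one (t⁻¹ * x i)
        have h3 : ((⌊t⁻¹ * x i⌋ : ℤ) : ℝ) ≤ ((l i + 1 : ℤ) : ℝ) := by push_cast; linarith
        have h4 : (l i : ℝ) < ((⌊t⁻¹ * x i⌋ + 2 : ℤ) : ℝ) := by push_cast; linarith
        have h3' := Int.cast_le.1 h3
        have h4' := Int.cast_lt.1 h4
        omega
      rw [if_pos hlQ]
      apply (hC t ht l x).mul ht.le (psl_smooth t l) (sq l)
      apply hq l hl
      have := norm_sub_lv ht hx
      linarith
    · push Not at hx
      obtain ⟨i, hi⟩ := hx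
      have hz : (fun _ => (0:ℝ)) =ᶠ[nhds x] (fun y => psl t l y * q l y) := by
        have : Continuous (fun y : Euc n => |t⁻¹ * y i - l i|) := by fun_prop
        filter_upwards [this.continuousAt.eventually (lt_mem_nhds hi)] with y hy
        rw [psl_eq, Finset.prod_eq_zero (Finset.mem_univ i) (hb_zero hy.le), zero_mul]
      refine (WB.const (0:ℝ) x).congr hz |>.mono ?_
      rw [abs_zero]
      split_ifs
      · positivity
      · exact le_rfl
  refine (WB.sum ht.le A (fun l => (psl_smooth t l).mul (sq l)) key).mono ?_
  rw [← Finset.sum_filter, Finset.sum_const, nsmul_eq_mul]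
  have hcard : ((A.filter (· ∈ Q)).card : ℝ) ≤ 3 ^ n := by
    have h1 : (A.filter (· ∈ Q)).card ≤ Q.card :=
      Finset.card_le_card fun l hl => (Finset.mem_filter.1 hl).2
    have h2 : Q.card = 3 ^ n := by
      rw [hQ, Fintype.card_piFinset]
      simp only [Int.card_Icc]
      have : ∀ i : Fin n, (⌊t⁻¹ * x i⌋ + 1 + 1 - (⌊t⁻¹ * x i⌋ - 1)).toNat = 3 := by
        intro i; omega
      simp [this]
    rw [h2] at h1
    exact_mod_cast h1
  calc _ ≤ (3:ℝ) ^ n * (2 ^ k * (C * B)) := by gcongr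
    _ = _ := by ring

lemma lattice_finite {n : ℕ} {t : ℝ} (ht : 0 < t) (K : ℝ) : {l : Fin n → ℤ | ‖t • lv l‖ ≤ K}.Finite := by
  set N : ℤ := ⌈K / t⌉
  apply (Set.Finite.pi' (fun _ : Fin n => Set.finite_Icc (-N) N)).subset
  intro l hl i
  rw [Set.mem_ofPred_eq, norm_smul, Real.norm_of_nonneg ht.le] at hl
  have h1 : |(l i : ℝ)| ≤ ‖lv l‖ := PiLp.norm_apply_le (lv l) i
  have h2 : |(l i : ℝ)| ≤ K / t := by
    rw [le_div_iff₀ ht, mul_comm]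
    exact (mul_le_mul_of_nonneg_left h1 ht.le).trans hl
  have h3 : |(l i : ℝ)| ≤ (N : ℝ) := h2.trans (Int.le_ceil _)
  rw [abs_le] at h3
  constructor
  · exact_mod_cast h3.1
  · exact_mod_cast h3.2

lemma lattice_near_finite {n : ℕ} {E : Set (Euc n)} (hE : Bornology.IsBounded E) (hne : E.Nonempty)
    {t : ℝ} (ht : 0 < t) (K : ℝ) : {l : Fin n → ℤ | infDist (t • lv l) E ≤ K}.Finite := by
  obtain ⟨ρ, hρ⟩ := hE.subset_closedBall 0
  apply (lattice_finite (n := n) ht (ρ + K + 1)).subset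
  intro l hl
  have hl' : infDist (t • lv l) E < K + 1 := lt_of_le_of_lt hl (by linarith)
  obtain ⟨a, ha, hd⟩ := (infDist_lt_iff hne).1 hl'
  have h1 := mem_closedBall_zero_iff.1 (hρ ha)
  rw [dist_eq_norm] at hd
  show ‖t • lv l‖ ≤ _
  calc ‖t • lv l‖ = ‖(t • lv l - a) + a‖ := by simp
    _ ≤ _ := norm_add_le _ _
    _ ≤ _ := by linarith

lemma cutoff (n k : ℕ) : ∃ C : ℝ, 1 ≤ C ∧ ∀ E : Set (Euc n), Bornology.IsBounded E → E.Nonempty →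
    ∀ t : ℝ, 0 < t → ∃ θ : Euc n → ℝ, ContDiff ℝ ∞ θ ∧ (∀ x, WB k t θ x C) ∧
      (∀ x, infDist x E ≤ t → θ =ᶠ[nhds x] fun _ => 1) ∧
      (∀ x, 2 * t ≤ infDist x E → WB k t θ x 0) := by
  obtain ⟨C, hC1, hC⟩ := lattice_WB n k
  set R : ℝ := Real.sqrt n + 1 with hR
  have hR1 : 1 ≤ R := by rw [hR]; linarith [Real.sqrt_nonneg (n:ℝ)]
  have hc1 : 1 ≤ 4 * R := by linarith
  refine ⟨(4 * R) ^ k * C, one_le_mul_of_one_le_of_one_le (one_le_pow₀ hc1) hC1,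
    fun E hE hne t ht => ?_⟩
  set τ : ℝ := t / (4 * R) with hτ
  have hτ0 : 0 < τ := by positivity
  have hRτ : R * τ = t / 4 := by rw [hτ]; field_simp
  have hτt : t ≤ 4 * R * τ := by linarith
  set A := (lattice_near_finite hE hne hτ0 (3/2 * t)).toFinset with hA
  have memA : ∀ l, l ∈ A ↔ infDist (τ • lv l) E ≤ 3/2 * t := by
    intro l; rw [hA, Set.Finite.mem_toFinset]; rfl
  have hlip : ∀ (x : Euc n) l, ‖x - τ • lv l‖ ≤ R * τ →
      |infDist x E - infDist (τ • lv l) E| ≤ t / 4 := by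
    intro x l h
    have h1 := infDist_le_infDist_add_dist (s := E) (x := x) (y := τ • lv l)
    have h2 := infDist_le_infDist_add_dist (s := E) (x := τ • lv l) (y := x)
    rw [dist_comm] at h2
    rw [dist_eq_norm] at h1 h2
    rw [abs_le]; constructor <;> linarith
  have e : (fun y => ∑ l ∈ A, psl τ l y) = fun y => ∑ l ∈ A, psl τ l y * (fun _ _ => (1:ℝ)) l y := by
    simp
  refine ⟨fun y => ∑ l ∈ A, psl τ l y, ContDiff.sum fun l _ => psl_smooth τ l, ?_, ?_, ?_⟩
  · intro x
    have := hC τ hτ0 x A (fun _ _ => (1:ℝ)) 1 zero_le_one (fun _ => contDiff_const)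
      (fun l _ _ => (WB.const (1:ℝ) x).mono (by simp))
    rw [← e, mul_one] at this
    exact this.scale hc1 ht.le hτ0.le hτt
  · intro x hx
    apply psl_sum_near hτ0
    intro l hl
    rw [memA]
    have := abs_le.1 (hlip x l hl)
    linarith
  · intro x hx
    have := hC τ hτ0 x A (fun _ _ => (1:ℝ)) 0 le_rfl (fun _ => contDiff_const)
      (fun l hl hxl => by
        exfalso
        rw [memA] at hl
        have := abs_le.1 (hlip x l hxl)
        linarith)
    rw [← e, mul_zero] at this
    exact (this.scale hc1 ht.le hτ0.le hτt).mono (by simp)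

lemma local_approx (n k : ℕ) : ∃ C : ℝ, 1 ≤ C ∧ ∀ E : Set (Euc n), Bornology.IsBounded E →
    E.Nonempty → ∀ (P : Euc n → Euc n → ℝ) (M : ℝ), 0 ≤ M →
    (∀ a ∈ E, IsPolyFun n (k-1) (P a)) →
    (∀ a ∈ E, ∀ b ∈ E, ∀ z, |P a z - P b z| ≤ M * (‖z - a‖ + ‖z - b‖) ^ k) →
    ∀ t : ℝ, 0 < t → ∃ U : Euc n → ℝ, ContDiff ℝ ∞ U ∧
      ∀ x, ∀ a ∈ E, ‖x - a‖ ≤ 4 * t → WB k t (fun y => U y - P a y) x (C * M * t ^ k) := by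
  obtain ⟨C, hC1, hC⟩ := lattice_WB n k
  obtain ⟨C', hC1', hC'⟩ := poly_markov n (k-1) k
  set R : ℝ := Real.sqrt n + 1 with hR
  have hR1 : 1 ≤ R := by rw [hR]; linarith [Real.sqrt_nonneg (n:ℝ)]
  refine ⟨C * C' * (2 * R + 11) ^ k, ?_, fun E hE hne P M hM hP W t ht => ?_⟩
  · exact one_le_mul_of_one_le_of_one_le (one_le_mul_of_one_le_of_one_le hC1 hC1')
      (one_le_pow₀ (by linarith))
  set A := (lattice_near_finite hE hne ht ((R + 4) * t)).toFinset with hA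
  have memA : ∀ l, l ∈ A ↔ infDist (t • lv l) E ≤ (R + 4) * t := by
    intro l; rw [hA, Set.Finite.mem_toFinset]; rfl
  have hsel : ∀ l : Fin n → ℤ, ∃ a ∈ E, dist (t • lv l) a < infDist (t • lv l) E + t := fun l =>
    (infDist_lt_iff hne).1 (by linarith)
  choose a haE had using hsel
  refine ⟨fun y => ∑ l ∈ A, psl t l y * P (a l) y,
    ContDiff.sum fun l _ => (psl_smooth t l).mul (hP _ (haE l)).smooth, ?_⟩
  intro x b hb hxb
  have hnear : ∀ l, ‖x - t • lv l‖ ≤ R * t → l ∈ A := by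
    intro l hl
    rw [memA]
    have h1 := infDist_le_infDist_add_dist (s := E) (x := t • lv l) (y := x)
    have h2 := infDist_le_dist_of_mem (x := x) hb
    rw [dist_eq_norm] at h1 h2
    rw [norm_sub_rev] at h1
    linarith
  have hsum := psl_sum_near ht x A hnear
  have main := hC t ht x A (fun l y => P (a l) y - P b y) (C' * (M * ((2 * R + 11) * t) ^ k))
    (by positivity) (fun l => ((hP _ (haE l)).smooth).sub (hP _ hb).smooth) ?_
  · refine (main.mono (le_of_eq ?_)).congr ?_
    · rw [mul_pow]; ring
    · filter_upwards [hsum] with y hy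
      simp only [mul_sub, Finset.sum_sub_distrib]
      rw [← Finset.sum_mul, hy, one_mul]
  · intro l hl hxl
    rw [memA] at hl
    apply hC' _ ((hP _ (haE l)).sub (hP _ hb)) x t _ ht
    intro z hz
    rw [mem_closedBall, dist_eq_norm] at hz
    refine (W _ (haE l) _ hb z).trans ?_
    have h1 := had l
    rw [dist_eq_norm] at h1
    have h2 : ‖z - a l‖ ≤ ‖z - x‖ + ‖x - t • lv l‖ + ‖t • lv l - a l‖ := by
      calc _ = ‖(z - x) + (x - t • lv l) + (t • lv l - a l)‖ := by congr 1; abel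
        _ ≤ _ := norm_add₃_le
    have h3 : ‖z - b‖ ≤ ‖z - x‖ + ‖x - b‖ := by
      calc _ = ‖(z - x) + (x - b)‖ := by congr 1; abel
        _ ≤ _ := norm_add_le _ _
    gcongr
    linarith

lemma whitney (n k : ℕ) (hk : 0 < k) (E : Set (Euc n)) (hE : Bornology.IsBounded E)
    (hne : E.Nonempty) (P : Euc n → Euc n → ℝ) (M N : ℝ) (hM : 0 ≤ M)
    (hP : ∀ a ∈ E, IsPolyFun n (k-1) (P a))
    (hN : ∀ a ∈ E, ∀ z ∈ closedBall a 5, |P a z| ≤ N)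
    (W : ∀ a ∈ E, ∀ b ∈ E, ∀ z, |P a z - P b z| ≤ M * (‖z - a‖ + ‖z - b‖) ^ k) :
    ∃ B : ℝ, 0 < B ∧ ∃ u : Euc n → ℝ, MemLip n k B u ∧ ∀ a ∈ E, u a = P a a := by
  obtain ⟨C₁, hC₁1, hC₁⟩ := cutoff n k
  obtain ⟨C₂, hC₂1, hC₂⟩ := local_approx n k
  obtain ⟨C₃, hC₃1, hC₃⟩ := poly_markov n (k-1) k
  set t : ℕ → ℝ := fun j => (1/2 : ℝ) ^ j with htdef
  have ht : ∀ j, 0 < t j := fun j => by simp only [htdef]; positivity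
  have ht1 : ∀ j, t j ≤ 1 := fun j => pow_le_one₀ (by norm_num) (by norm_num)
  have hts : ∀ j, t j = 2 * t (j+1) := fun j => by simp only [htdef, pow_succ]; ring
  have ht0 : t 0 = 1 := by simp [htdef]
  choose θ sθ θb θ1 θ0 using fun j => hC₁ E hE hne (t j) (ht j)
  choose U sU hU using fun j => hC₂ E hE hne P M hM hP W (t j) (ht j)
  have hN0 : 0 ≤ N := by
    obtain ⟨a, ha⟩ := hne
    exact (abs_nonneg _).trans (hN a ha a (mem_closedBall_self (by norm_num)))
  have Pb : ∀ a ∈ E, ∀ x, ‖x - a‖ ≤ 4 → WB k 1 (P a) x (C₃ * N) := by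
    intro a ha x hx
    apply hC₃ _ (hP a ha) x 1 N one_pos
    intro z hz
    apply hN a ha
    have := dist_triangle z x a
    rw [mem_closedBall] at hz ⊢
    rw [dist_eq_norm x a] at this
    linarith
  -- bounds on U j
  set B₀ : ℝ := C₃ * N + C₂ * M with hB₀
  have hC₂M : 0 ≤ C₂ * M := by positivity
  have Ub : ∀ j, ∀ x, infDist x E < 4 * t j → ∀ i ≤ k, ‖iteratedFDeriv ℝ i (U j) x‖ ≤ B₀ := by
    intro j x hx i hi
    obtain ⟨a, ha, hd⟩ := (infDist_lt_iff hne).1 hx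
    rw [dist_eq_norm] at hd
    have h1 := hU j x a ha hd.le i hi
    have h2 := Pb a ha x (hd.le.trans (by linarith [ht1 j])) i hi
    rw [one_pow, one_mul] at h2
    have e : iteratedFDeriv ℝ i (U j) x = iteratedFDeriv ℝ i (P a) x +
        iteratedFDeriv ℝ i (fun y => U j y - P a y) x := by
      rw [← iteratedFDeriv_add_apply (((hP a ha).smooth.of_le (nat_le_infty i)).contDiffAt)
        ((((sU j).sub (hP a ha).smooth).of_le (nat_le_infty i)).contDiffAt)]
      congr 1
      funext y; simp
    have h3 : ‖iteratedFDeriv ℝ i (fun y => U j y - P a y) x‖ ≤ C₂ * M := by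
      have hti : 0 < t j ^ i := pow_pos (ht j) i
      have : t j ^ k ≤ t j ^ i := pow_le_pow_of_le_one (ht j).le (ht1 j) hi
      by_contra hcon
      push Not at hcon
      have : C₂ * M * t j ^ k ≤ C₂ * M * t j ^ i := by gcongr
      have : t j ^ i * (C₂ * M) < t j ^ i * ‖iteratedFDeriv ℝ i (fun y => U j y - P a y) x‖ := by
        gcongr
      linarith
    rw [e]
    exact (norm_add_le _ _).trans (by linarith)
  set v : ℕ → Euc n → ℝ := fun j => Nat.rec (fun y => θ 0 y * U 0 y)
    (fun j _ => fun y => θ (j+1) y * (U (j+1) y - U j y)) j with hv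
  have v0 : v 0 = fun y => θ 0 y * U 0 y := rfl
  have vs : ∀ j, v (j+1) = fun y => θ (j+1) y * (U (j+1) y - U j y) := fun j => rfl
  have sv : ∀ j, ContDiff ℝ ∞ (v j) := by
    intro j
    cases j with
    | zero => rw [v0]; exact (sθ 0).mul (sU 0)
    | succ j => rw [vs]; exact (sθ _).mul ((sU _).sub (sU _))
  set K : ℝ := 2 ^ k * (C₁ * B₀) + 2 ^ k * (C₁ * (C₂ * M + 2 ^ k * (C₂ * M * 2 ^ k))) with hK
  have hB₀0 : 0 ≤ B₀ := by positivity
  have hK0 : 0 ≤ K := by positivity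
  have vb : ∀ j x, WB k (t j) (v j) x (K * t j ^ k) := by
    intro j x
    by_cases hx : 2 * t j ≤ infDist x E
    · have : WB k (t j) (v j) x 0 := by
        cases j with
        | zero => exact (θ0 0 x hx).zero_mul (ht 0).le (sθ 0) (sU 0)
        | succ j => exact (θ0 _ x hx).zero_mul (ht _).le (sθ _) ((sU (j+1)).sub (sU j))
      exact this.mono (by have := ht j; positivity)
    · push Not at hx
      cases j with
      | zero =>
        rw [ht0] at hx ⊢
        have h1 : WB k 1 (U 0) x B₀ := by
          intro i hi
          rw [one_pow, one_mul]
          exact Ub 0 x (by rw [ht0]; linarith) i hi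
        have hθ := θb 0 x
        rw [ht0] at hθ
        refine (hθ.mul zero_le_one (sθ 0) (sU 0) h1).mono ?_
        rw [one_pow, mul_one, hK]
        have : 0 ≤ 2 ^ k * (C₁ * (C₂ * M + 2 ^ k * (C₂ * M * 2 ^ k))) := by positivity
        linarith
      | succ j =>
        obtain ⟨a, ha, hd⟩ := (infDist_lt_iff hne).1 hx
        rw [dist_eq_norm] at hd
        have p := ht (j+1)
        have h1 := hU (j+1) x a ha (by linarith)
        have h2 := hU j x a ha (by rw [hts j]; linarith)
        have h2' := (h2.scale (s := t (j+1)) le_rfl p.le (ht j).le (by rw [hts j]; linarith))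
        have h3 : WB k (t (j+1)) (fun y => (-1:ℝ) * (U j y - P a y)) x _ :=
          (WB.const (-1:ℝ) x).mul p.le contDiff_const
          ((sU j).sub (hP a ha).smooth) h2'
        have h4 := h1.add p.le ((sU (j+1)).sub (hP a ha).smooth)
          (contDiff_const.mul ((sU j).sub (hP a ha).smooth)) h3
        have e : (fun y => U (j+1) y - P a y + (-1:ℝ) * (U j y - P a y)) =
            fun y => U (j+1) y - U j y := by funext y; ring
        rw [e] at h4
        refine ((θb (j+1) x).mul p.le (sθ _) ((sU _).sub (sU _)) h4).mono ?_
        rw [hts j, mul_pow, abs_neg, abs_one, one_pow, one_mul, one_mul, hK]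
        have : 0 ≤ 2 ^ k * (C₁ * B₀) * t (j+1) ^ k := by positivity
        refine le_trans (le_of_eq ?_) (le_trans (le_add_of_nonneg_left this) (le_of_eq
          (add_mul _ _ _).symm))
        ring
  have vb' : ∀ i ≤ k, ∀ j x, ‖iteratedFDeriv ℝ i (v j) x‖ ≤ K * t j ^ (k - i) := by
    intro i hi j x
    have h1 := vb j x i hi
    have hti : 0 < t j ^ i := pow_pos (ht j) i
    have : t j ^ k = t j ^ i * t j ^ (k - i) := by rw [← pow_add]; congr 1; omega
    rw [this, ← mul_assoc, mul_comm K, mul_assoc] at h1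
    exact le_of_mul_le_mul_left h1 hti
  -- partial sums
  set s : ℕ → Euc n → ℝ := fun m y => ∑ j ∈ Finset.range m, v j y with hs
  have ss : ∀ m, ContDiff ℝ ∞ (s m) := fun m => ContDiff.sum fun j _ => sv j
  have hsucc : ∀ m, s (m+1) = fun y => s m y + v m y := fun m => by
    funext y; simp only [hs]; rw [Finset.sum_range_succ]
  have snear : ∀ m x, infDist x E ≤ t m → s (m+1) =ᶠ[nhds x] U m := by
    intro m
    induction m with
    | zero =>
      intro x hx
      filter_upwards [θ1 0 x hx] with y hy
      simp [hs, v0, hy]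
    | succ m ih =>
      intro x hx
      filter_upwards [θ1 (m+1) x hx, ih x (by rw [hts m]; linarith [ht (m+1)])] with y hy hy'
      rw [hsucc (m+1)]
      simp only [vs, hy, hy']
      ring
  have sb : ∀ m, ∀ i ≤ k, ∀ x, ‖iteratedFDeriv ℝ i (s (m+1)) x‖ ≤ B₀ + K := by
    intro m i hi
    induction m with
    | zero =>
      intro x
      have : s (0+1) = v 0 := by funext y; simp [hs]
      rw [this]
      have := vb' i hi 0 x
      rw [ht0, one_pow, mul_one] at this
      linarith
    | succ m ih =>
      intro x
      have e : iteratedFDeriv ℝ i (s (m+1+1)) x = iteratedFDeriv ℝ i (s (m+1)) x +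
          iteratedFDeriv ℝ i (v (m+1)) x := by
        rw [hsucc (m+1)]
        exact iteratedFDeriv_add_apply (((ss (m+1)).of_le (nat_le_infty i)).contDiffAt)
          (((sv (m+1)).of_le (nat_le_infty i)).contDiffAt)
      by_cases hx : 2 * t (m+1) ≤ infDist x E
      · have h0 : WB k (t (m+1)) (v (m+1)) x 0 :=
          (θ0 _ x hx).zero_mul (ht _).le (sθ _) ((sU (m+1)).sub (sU m))
        have h1 := h0 i hi
        have hti : 0 < t (m+1) ^ i := pow_pos (ht _) i
        have h2 : ‖iteratedFDeriv ℝ i (v (m+1)) x‖ ≤ 0 := by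
          by_contra hcon
          push Not at hcon
          have := mul_pos hti hcon
          linarith
        rw [e]
        exact (norm_add_le _ _).trans (by linarith [ih x])
      · push Not at hx
        have h1 := snear m x (by rw [hts m]; exact hx.le)
        have h2 := Ub m x (by rw [hts m]; linarith [ht (m+1)]) i hi
        rw [← (h1.iteratedFDeriv ℝ i).eq_of_nhds] at h2
        have h3 := vb' i hi (m+1) x
        have h4 : K * t (m+1) ^ (k - i) ≤ K * 1 := by
          gcongr; exact pow_le_one₀ (ht _).le (ht1 _)
        rw [e]
        exact (norm_add_le _ _).trans (by linarith)
  have hmem := memLip_of_series k (B₀ + K + 1) v sv (fun i j => K * t j ^ (k - i)) ?_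
    (fun i hi j x => vb' i hi.le j x) ?_
  · refine ⟨B₀ + K + 1, by positivity, _, hmem, ?_⟩
    intro a ha
    have hsumm : Summable (fun j => v j a) := by
      apply Summable.of_norm_bounded (g := fun j => K * t j ^ k)
      · apply Summable.mul_left
        simp only [htdef, ← pow_mul, mul_comm _ k]
        simp only [pow_mul]
        exact summable_geometric_of_lt_one (by positivity)
          (pow_lt_one₀ (by norm_num) (by norm_num) hk.ne')
      · intro j
        rw [Real.norm_eq_abs]
        exact (vb j a).abs_le
    have h1 : Tendsto (fun m => s (m+1) a) atTop (nhds (∑' j, v j a)) :=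
      (tendsto_add_atTop_iff_nat 1).2 hsumm.hasSum.tendsto_sum_nat
    have h2 : Tendsto (fun m => s (m+1) a) atTop (nhds (P a a)) := by
      rw [tendsto_iff_norm_sub_tendsto_zero]
      refine squeeze_zero (fun _ => norm_nonneg _) (g := fun m => C₂ * M * t m ^ k) ?_ ?_
      · intro m
        rw [(snear m a (by rw [infDist_zero_of_mem ha]; exact (ht m).le)).eq_of_nhds,
          Real.norm_eq_abs]
        exact (hU m a a ha (by simp [(ht m).le])).abs_le
      · rw [← mul_zero (C₂ * M)]
        apply Tendsto.const_mul
        have : Tendsto t atTop (nhds 0) :=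
          tendsto_pow_atTop_nhds_zero_of_lt_one (by norm_num) (by norm_num)
        have := this.pow k
        rwa [zero_pow hk.ne'] at this
    exact tendsto_nhds_unique h1 h2
  · intro i hi
    apply Summable.mul_left
    simp only [htdef, ← pow_mul, mul_comm _ (k - i)]
    simp only [pow_mul]
    exact summable_geometric_of_lt_one (by positivity)
      (pow_lt_one₀ (by norm_num) (by norm_num) (by omega))
  · intro i hi m x
    cases m with
    | zero =>
      have : iteratedFDeriv ℝ i (fun y : Euc n => ∑ j ∈ Finset.range 0, v j y) x = 0 := by
        have : (fun y : Euc n => ∑ j ∈ Finset.range 0, v j y) = 0 := by funext y; simp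
        rw [this]; simp
      rw [this, norm_zero]; positivity
    | succ m => exact (sb m i hi x).trans (by linarith)

lemma meas_indicator {n : ℕ} {D : Set (Euc n)} (hD : MeasurableSet D) {f : Euc n → ℝ}
    (hf : Measurable (D.restrict f)) : Measurable (D.indicator f) := by
  apply measurable_of_measurable_union_cover D Dᶜ hD hD.compl (by simp)
  · have : (fun a : D => D.indicator f a) = D.restrict f := by
      funext a; exact Set.indicator_of_mem a.2 f
    rw [this]; exact hf
  · have : (fun a : (Dᶜ : Set (Euc n)) => D.indicator f a) = fun _ => 0 := by
      funext a; exact Set.indicator_of_notMem a.2 f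
    rw [this]; exact measurable_const

lemma vol_ball_pos {n : ℕ} (x : Euc n) {r : ℝ} (hr : 0 < r) : volume (ball x r) ≠ 0 :=
  (measure_ball_pos volume x hr).ne'

lemma vol_ball_top {n : ℕ} (x : Euc n) (r : ℝ) : volume (ball x r) ≠ ⊤ :=
  measure_ball_lt_top.ne

lemma density_ae {n : ℕ} (S : Set (Euc n)) : ∀ᵐ x ∂(volume.restrict S), DensityOneAt S x := by
  filter_upwards [Besicovitch.ae_tendsto_measure_inter_div (volume : Measure (Euc n)) S] with x hx
  refine hx.congr' ?_
  filter_upwards [self_mem_nhdsWithin] with r hr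
  have hae : (ball x r : Set (Euc n)) =ᵐ[volume] closedBall x r := by
    refine Filter.EventuallyLE.antisymm ball_subset_closedBall.eventuallyLE ?_
    rw [ae_le_set, closedBall_sdiff_ball]
    exact Measure.addHaar_sphere_of_ne_zero volume x (ne_of_gt hr)
  rw [measure_congr hae, measure_congr ((ae_eq_refl S).inter hae)]

lemma DensityOneAt.mono {n : ℕ} {S T : Set (Euc n)} {x : Euc n} (h : DensityOneAt S x)
    (hST : S ⊆ T) : DensityOneAt T x := by
  refine tendsto_of_tendsto_of_tendsto_of_le_of_le h tendsto_const_nhds ?_ ?_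
  · intro r
    exact ENNReal.div_le_div_right (measure_mono (Set.inter_subset_inter_left _ hST)) _
  · intro r
    exact (ENNReal.div_le_div_right (measure_mono Set.inter_subset_right) _).trans ENNReal.div_self_le_one

lemma DensityOneAt.compl_small {n : ℕ} {S : Set (Euc n)} {x : Euc n} (h : DensityOneAt S x)
    (hS : MeasurableSet S) {η : ℝ} (hη : 0 < η) :
    ∃ δ : ℝ, 0 < δ ∧ ∀ r, 0 < r → r < δ →
      volume (Sᶜ ∩ ball x r) ≤ ENNReal.ofReal η * volume (ball x r) := by
  have h1 : ∀ᶠ r in nhdsWithin (0:ℝ) (Set.Ioi 0), 1 - ENNReal.ofReal η <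
      volume (S ∩ ball x r) / volume (ball x r) := by
    apply h.eventually_const_lt
    exact ENNReal.sub_lt_self ENNReal.one_ne_top one_ne_zero (by simpa using hη)
  rw [eventually_nhdsWithin_iff, Metric.eventually_nhds_iff] at h1
  obtain ⟨δ, hδ, H⟩ := h1
  refine ⟨δ, hδ, fun r hr hrδ => ?_⟩
  have h2 := H (y := r) (by rw [Real.dist_eq, sub_zero, abs_of_pos hr]; exact hrδ) hr
  set V := volume (ball x r) with hV
  have hV0 : V ≠ 0 := vol_ball_pos x hr
  have hVt : V ≠ ⊤ := vol_ball_top x r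
  have h3 : (1 - ENNReal.ofReal η) * V ≤ volume (S ∩ ball x r) := by
    have := ENNReal.mul_le_of_le_div h2.le
    exact this
  have h4 : volume (S ∩ ball x r) + volume (Sᶜ ∩ ball x r) = V := by
    rw [hV, ← measure_inter_add_sdiff (ball x r) hS, Set.inter_comm S, Set.inter_comm Sᶜ]
    rfl
  have h5 : V ≤ volume (S ∩ ball x r) + ENNReal.ofReal η * V := by
    calc V = 1 * V := (one_mul _).symm
      _ ≤ ((1 - ENNReal.ofReal η) + ENNReal.ofReal η) * V := by gcongr; exact le_tsub_add
      _ = (1 - ENNReal.ofReal η) * V + ENNReal.ofReal η * V := by rw [add_mul]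
      _ ≤ _ := by gcongr
  have hfin : volume (S ∩ ball x r) ≠ ⊤ := ne_top_of_le_ne_top hVt (measure_mono Set.inter_subset_right)
  have h6 := h4.le.trans h5
  exact (ENNReal.add_le_add_iff_left hfin).1 h6

lemma DJ_zero {n : ℕ} (u : Euc n → ℝ) : DJ (0 : Fin n → ℕ) u = u := by
  have : multiList n 0 = [] := by
    rw [← List.length_eq_zero_iff, length_multiList]; simp [mdeg]
  unfold DJ
  rw [this]; rfl

lemma MemLip.est {n k : ℕ} (hk : 0 < k) {M : ℝ} {u : Euc n → ℝ} (h : MemLip n k M u) (x x₀ : Euc n) :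
    |u x - TaylorPoly k u x₀ x| ≤ M * ‖x - x₀‖ ^ k := by
  have h0 : mdeg (0 : Fin n → ℕ) = 0 := by simp [mdeg]
  have := (h.2 0 (by rw [h0]; exact hk) x x₀).2
  rwa [DJ_zero, DJ_zero, h0, Nat.sub_zero] at this

lemma TaylorPoly_poly {n k : ℕ} (u : Euc n → ℝ) (x₀ : Euc n) :
    IsPolyFun n (k-1) (TaylorPoly k u x₀) := by
  have e : TaylorPoly k u x₀ = fun x => ∑ I ∈ multiIdxLt n k,
      (DJ I u x₀ / (Jfact I : ℝ)) * ∏ i, ((fun i => - x₀ i) i + 1 * x i) ^ (fun I i => I i) I i := by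
    funext x
    unfold TaylorPoly mpow
    apply Finset.sum_congr rfl
    intro I _
    have : ∀ i, (x - x₀) i = - x₀ i + 1 * x i := fun i => by simp; ring
    simp only [this]
    ring
  rw [e]
  apply isPolyFun_sum
  intro I hI
  have := (mem_multiIdxLt I).1 hI
  unfold mdeg at this
  show ∑ i, I i ≤ _
  omega

lemma MemLip.cont {n k : ℕ} (hk : 0 < k) {M : ℝ} {u : Euc n → ℝ} (h : MemLip n k M u) :
    Continuous u := by
  rw [continuous_iff_continuousAt]
  intro x₀
  have hT : Continuous (TaylorPoly k u x₀) := (TaylorPoly_poly u x₀).smooth.continuous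
  have h0 : u x₀ = TaylorPoly k u x₀ x₀ := by
    have := h.est hk x₀ x₀
    rw [sub_self, norm_zero, zero_pow hk.ne', mul_zero] at this
    exact sub_eq_zero.1 (abs_nonpos_iff.1 this)
  have h1 : Tendsto (fun x => u x - TaylorPoly k u x₀ x) (nhds x₀) (nhds 0) := by
    rw [tendsto_zero_iff_norm_tendsto_zero]
    refine squeeze_zero (fun _ => norm_nonneg _) (g := fun x => M * ‖x - x₀‖ ^ k)
      (fun x => h.est hk x x₀) ?_
    have : Continuous (fun x : Euc n => M * ‖x - x₀‖ ^ k) := by fun_prop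
    have := this.tendsto x₀
    rwa [sub_self, norm_zero, zero_pow hk.ne', mul_zero] at this
  have h2 := h1.add (hT.tendsto x₀)
  rw [zero_add, ← h0] at h2
  refine h2.congr fun x => ?_
  ring

lemma meas_eqset {n : ℕ} {D : Set (Euc n)} (hD : MeasurableSet D) {f : Euc n → ℝ}
    (hf : Measurable (D.restrict f)) {u : Euc n → ℝ} (hu : Continuous u) :
    MeasurableSet {x | x ∈ D ∧ u x = f x} := by
  have e : {x | x ∈ D ∧ u x = f x} = D ∩ {x | u x = D.indicator f x} := by
    ext x
    constructor
    · rintro ⟨h1, h2⟩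
      refine ⟨h1, ?_⟩
      show u x = _
      rw [Set.indicator_of_mem h1]; exact h2
    · rintro ⟨h1, h2⟩
      refine ⟨h1, ?_⟩
      have h2 : u x = D.indicator f x := h2
      rwa [Set.indicator_of_mem h1] at h2
  rw [e]
  exact hD.inter (measurableSet_eq_fun hu.measurable (meas_indicator hD hf))

lemma dir21 (n k : ℕ) (hk : 0 < k)
    (D : Set (Euc n)) (hD : MeasurableSet D)
    (f : Euc n → ℝ) (hf : Measurable (D.restrict f))
    (H : ∀ ε : ℝ, 0 < ε → ∃ M : ℝ, 0 < M ∧ ∃ u : Euc n → ℝ, MemLip n k M u ∧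
      volume {x | x ∈ D ∧ u x ≠ f x} < ENNReal.ofReal ε) :
    ∀ᵐ x₀ ∂(volume.restrict D), ∃ p : Euc n → ℝ, HasApproxTaylorAt k D f x₀ p := by
  choose M hM u hu hvol using fun m : ℕ => H (1 / ((m:ℝ) + 1)) (by positivity)
  have h1 : ∀ m, ∀ᵐ x, x ∈ {x | x ∈ D ∧ u m x = f x} → DensityOneAt {x | x ∈ D ∧ u m x = f x} x :=
    fun m => (ae_restrict_iff' (meas_eqset hD hf ((hu m).cont hk))).1 (density_ae _)
  have h2 : ∀ᵐ x, ∃ m, x ∈ D → u m x = f x := by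
    rw [ae_iff]
    refine le_antisymm ?_ (zero_le)
    have hle : ∀ m : ℕ, volume {x | ¬ ∃ m, x ∈ D → u m x = f x} ≤ ENNReal.ofReal (1 / ((m:ℝ) + 1)) := by
      intro m
      refine (measure_mono ?_).trans (hvol m).le
      intro x hx
      have hx : ¬ ∃ m, x ∈ D → u m x = f x := hx
      push Not at hx
      exact hx m
    have hlim : Tendsto (fun m : ℕ => ENNReal.ofReal (1 / ((m:ℝ) + 1))) atTop (nhds 0) := by
      have := ENNReal.tendsto_ofReal (tendsto_one_div_add_atTop_nhds_zero_nat (𝕜 := ℝ))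
      rwa [ENNReal.ofReal_zero] at this
    exact ge_of_tendsto' hlim hle
  rw [ae_restrict_iff' hD]
  filter_upwards [ae_all_iff.2 h1, h2] with x hx1 hx2 hxD
  obtain ⟨m, hm⟩ := hx2
  have hd := hx1 m ⟨hxD, hm hxD⟩
  refine ⟨TaylorPoly k (u m) x, hd.mono (fun z hz => hz.1), TaylorPoly_poly _ _, M m, hM m, ?_⟩
  refine DensityOneAt.mono hd ?_
  rintro z ⟨hz1, hz2⟩ ⟨_, hz3⟩
  rw [← hz2] at hz3
  exact absurd ((hu m).est hk z x) (not_le.2 hz3)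

/-- The set where `f` deviates from `p`. -/
def badset {n : ℕ} (k : ℕ) (D : Set (Euc n)) (f : Euc n → ℝ) (x : Euc n) (p : Euc n → ℝ) (L : ℝ) :
    Set (Euc n) := {z | z ∉ D ∨ L * ‖z - x‖ ^ k < |f z - p z|}

/-- Uniform level sets. -/
def ES {n : ℕ} (k : ℕ) (D : Set (Euc n)) (f : Euc n → ℝ) (η L : ℝ) : Set (Euc n) :=
  {x | x ∈ D ∧ ‖x‖ ≤ L ∧ ∃ p, IsPolyFun n (k-1) p ∧ p x = f x ∧ (∀ z ∈ closedBall x 5, |p z| ≤ L) ∧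
    ∀ r, 0 < r → r ≤ 1 / L →
      volume (badset k D f x p L ∩ ball x r) ≤ ENNReal.ofReal η * volume (ball x r)}

lemma ES_mono {n k : ℕ} {D : Set (Euc n)} {f : Euc n → ℝ} {η L L' : ℝ} (hL : 0 < L) (h : L ≤ L') :
    ES k D f η L ⊆ ES k D f η L' := by
  rintro x ⟨h1, h2, p, h3, h4, h5, h6⟩
  refine ⟨h1, h2.trans h, p, h3, h4, fun z hz => (h5 z hz).trans h, fun r hr hr' => ?_⟩
  refine (measure_mono (Set.inter_subset_inter_left _ ?_)).trans
    (h6 r hr (hr'.trans (one_div_le_one_div_of_le hL h)))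
  rintro z (hz | hz)
  · exact Or.inl hz
  · exact Or.inr (lt_of_le_of_lt (by gcongr) hz)

lemma vol_ball_two {n : ℕ} (x y : Euc n) {r : ℝ} (hr : 0 < r) :
    volume (ball x (2 * r)) = ENNReal.ofReal (2 ^ n) * volume (ball y r) := by
  rw [Measure.addHaar_ball_of_pos volume x (by positivity : 0 < 2 * r),
    Measure.addHaar_ball_of_pos volume y hr, mul_pow, ENNReal.ofReal_mul (by positivity),
    finrank_euclideanSpace_fin, mul_assoc]

lemma ES_whitney (n k : ℕ) (hk : 0 < k) : ∃ η : ℝ, 0 < η ∧ ∀ (D : Set (Euc n)) (f : Euc n → ℝ) (L : ℝ),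
    0 < L → ∃ B : ℝ, 0 < B ∧ ∃ u : Euc n → ℝ, MemLip n k B u ∧ ∀ a ∈ ES k D f η L, u a = f a := by
  obtain ⟨η, C, hη, hC1, hC⟩ := poly_degiorgi n (k-1)
  refine ⟨η / (2 ^ n + 1), by positivity, fun D f L hL => ?_⟩
  set η' := η / (2 ^ n + 1) with hη'
  have hη'0 : 0 < η' := by positivity
  set E := ES k D f η' L with hE
  by_cases hne : E.Nonempty
  swap
  · refine ⟨1, one_pos, fun _ => 0, ?_, fun a ha => (hne ⟨a, ha⟩).elim⟩
    have := memLip_of_series k 1 (fun _ => (fun _ : Euc n => (0:ℝ))) (fun _ => contDiff_const)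
      (fun _ _ => 0) (fun _ _ => summable_zero) ?_ ?_
    · simpa using this
    · intro i _ j x
      have : (fun _ : Euc n => (0:ℝ)) = 0 := rfl
      rw [this]; simp
    · intro i _ m x
      have : (fun y : Euc n => ∑ j ∈ Finset.range m, (0:ℝ)) = 0 := by funext y; simp
      rw [this]; simp
  have hbdd : Bornology.IsBounded E := by
    refine (isBounded_closedBall (x := (0 : Euc n)) (r := L)).subset ?_
    intro x hx
    rw [mem_closedBall_zero_iff]
    exact hx.2.1
  have hsel : ∀ a : Euc n, ∃ p : Euc n → ℝ, a ∈ E → IsPolyFun n (k-1) p ∧ p a = f a ∧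
      (∀ z ∈ closedBall a 5, |p z| ≤ L) ∧ ∀ r, 0 < r → r ≤ 1 / L →
      volume (badset k D f a p L ∩ ball a r) ≤ ENNReal.ofReal η' * volume (ball a r) := by
    intro a
    by_cases ha : a ∈ E
    · obtain ⟨_, _, p, hp⟩ := ha
      exact ⟨p, fun _ => hp⟩
    · exact ⟨fun _ => 0, fun h => (ha h).elim⟩
  choose P hP using hsel
  set M₁ : ℝ := C * (L * (2 ^ k + 1)) with hM₁
  set M₂ : ℝ := 2 * (C * L * (2 * L + 1) ^ k) with hM₂
  have hM₁0 : 0 ≤ M₁ := by positivity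
  have hM₂0 : 0 ≤ M₂ := by positivity
  have grow : ∀ a ∈ E, ∀ z, |P a z| ≤ C * L * (max 1 (‖z - a‖ / 5)) ^ (k-1) := by
    intro a ha z
    apply hC _ (hP a ha).1 a 5 L (by norm_num)
    have : {z | z ∈ ball a 5 ∧ L < |P a z|} = ∅ := by
      rw [Set.eq_empty_iff_forall_notMem]
      rintro w ⟨h1, h2⟩
      exact absurd ((hP a ha).2.2.1 w (ball_subset_closedBall h1)) (not_le.2 h2)
    rw [this, measure_empty]; exact zero_le
  have hW : ∀ a ∈ E, ∀ b ∈ E, ∀ z, |P a z - P b z| ≤ (M₁ + M₂) * (‖z - a‖ + ‖z - b‖) ^ k := by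
    intro a ha b hb z
    set s := ‖z - a‖ + ‖z - b‖ with hs
    have hs0 : 0 ≤ s := by positivity
    set r := ‖a - b‖ with hr
    have hrs : r ≤ s := by
      calc r = ‖(z - b) - (z - a)‖ := by rw [hr]; congr 1; abel
        _ ≤ ‖z - b‖ + ‖z - a‖ := norm_sub_le _ _
        _ = s := by rw [hs]; ring
    by_cases hr0 : r = 0
    · have hab : a = b := sub_eq_zero.1 (norm_eq_zero.1 hr0)
      subst hab
      rw [sub_self, abs_zero]; positivity
    have hrpos : 0 < r := lt_of_le_of_ne (norm_nonneg _) (Ne.symm hr0)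
    by_cases hsmall : 2 * r ≤ 1 / L
    · have hin : ball b r ⊆ ball a (2 * r) := by
        intro w hw
        rw [mem_ball] at hw ⊢
        have := dist_triangle w b a
        rw [dist_comm b a, dist_eq_norm a b] at this
        linarith
      set A := L * ((2 * r) ^ k + r ^ k) with hA
      have hsub : {w | w ∈ ball b r ∧ A < |P a w - P b w|} ⊆
          (badset k D f a (P a) L ∩ ball a (2 * r)) ∪ (badset k D f b (P b) L ∩ ball b r) := by
        rintro w ⟨hw1, hw2⟩
        by_contra hcon
        rw [Set.mem_union, not_or] at hcon
        have c1 : w ∉ badset k D f a (P a) L := fun h => hcon.1 ⟨h, hin hw1⟩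
        have c2 : w ∉ badset k D f b (P b) L := fun h => hcon.2 ⟨h, hw1⟩
        have c1 : ¬ (w ∉ D ∨ L * ‖w - a‖ ^ k < |f w - P a w|) := c1
        have c2 : ¬ (w ∉ D ∨ L * ‖w - b‖ ^ k < |f w - P b w|) := c2
        push Not at c1 c2
        have d1 := hin hw1
        rw [mem_ball, dist_eq_norm] at d1 hw1
        have e1 : L * ‖w - a‖ ^ k ≤ L * (2 * r) ^ k := by gcongr
        have e2 : L * ‖w - b‖ ^ k ≤ L * r ^ k := by gcongr
        have e3 : |P a w - P b w| ≤ |f w - P b w| + |f w - P a w| := by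
          have : P a w - P b w = (f w - P b w) - (f w - P a w) := by ring
          rw [this]; exact abs_sub _ _
        have := c1.2
        have := c2.2
        rw [hA, mul_add] at hw2
        linarith
      have hmeas : volume {w | w ∈ ball b r ∧ A < |P a w - P b w|} ≤
          ENNReal.ofReal η * volume (ball b r) := by
        refine (measure_mono hsub).trans ((measure_union_le _ _).trans ?_)
        have g1 := (hP a ha).2.2.2 (2 * r) (by positivity) hsmall
        have g2 := (hP b hb).2.2.2 r hrpos (by linarith)
        rw [vol_ball_two a b hrpos] at g1
        refine (add_le_add g1 g2).trans (le_of_eq ?_)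
        rw [← mul_assoc, ← add_mul, ← ENNReal.ofReal_mul hη'0.le, ← ENNReal.ofReal_add (by positivity)
          hη'0.le]
        congr 2
        rw [hη']; field_simp
      have hfin := hC _ ((hP a ha).1.sub (hP b hb).1) b r A hrpos hmeas z
      have hA0 : 0 ≤ A := by positivity
      have hsr : 1 ≤ s / r := (one_le_div hrpos).2 hrs
      have hmax : max 1 (‖z - b‖ / r) ≤ s / r := by
        apply max_le hsr
        gcongr
        rw [hs]; linarith [norm_nonneg (z - a)]
      calc _ ≤ C * A * (max 1 (‖z - b‖ / r)) ^ (k-1) := hfin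
        _ ≤ C * A * (s / r) ^ (k-1) := by gcongr
        _ ≤ C * A * (s / r) ^ k := by
          gcongr
          omega
        _ = M₁ * s ^ k := by
          rw [hA, hM₁, div_pow, mul_pow]; field_simp
        _ ≤ _ := by gcongr; linarith
    · push Not at hsmall
      have hs1 : 1 ≤ 2 * L * s := by
        rw [div_lt_iff₀ hL] at hsmall
        nlinarith
      have one : ∀ c ∈ E, ‖z - c‖ ≤ s → |P c z| ≤ C * L * (2 * L + 1) ^ k * s ^ k := by
        intro c hc hcs
        have hm : max 1 (‖z - c‖ / 5) ≤ (2 * L + 1) * s := by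
          apply max_le
          · nlinarith
          · have : 0 ≤ 2 * L * s := by positivity
            linarith [norm_nonneg (z - c)]
        have h1 : 1 ≤ (2 * L + 1) * s := (le_max_left _ _).trans hm
        calc _ ≤ _ := grow c hc z
          _ ≤ C * L * ((2 * L + 1) * s) ^ (k-1) := by gcongr
          _ ≤ C * L * ((2 * L + 1) * s) ^ k := by
            gcongr
            omega
          _ = _ := by rw [mul_pow]; ring
      have o1 := one a ha (by rw [hs]; linarith [norm_nonneg (z - b)])
      have o2 := one b hb (by rw [hs]; linarith [norm_nonneg (z - a)])
      calc _ ≤ |P a z| + |P b z| := abs_sub _ _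
        _ ≤ M₂ * s ^ k := by rw [hM₂]; linarith
        _ ≤ _ := by gcongr; linarith
  obtain ⟨B, hB, u, hu, hua⟩ := whitney n k hk E hbdd hne P (M₁ + M₂) L (by positivity)
    (fun a ha => (hP a ha).1) (fun a ha => (hP a ha).2.2.1) hW
  exact ⟨B, hB, u, hu, fun a ha => (hua a ha).trans (hP a ha).2.1⟩

lemma meas_bad {n k : ℕ} {D : Set (Euc n)} (hD : MeasurableSet D) {f : Euc n → ℝ}
    (hf : Measurable (D.restrict f)) {p : Euc n → ℝ} (hp : Continuous p) (x : Euc n) (M : ℝ) :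
    MeasurableSet {z | z ∈ D ∧ M * ‖z - x‖ ^ k < |f z - p z|} := by
  have e : {z | z ∈ D ∧ M * ‖z - x‖ ^ k < |f z - p z|} =
      D ∩ {z | M * ‖z - x‖ ^ k < |D.indicator f z - p z|} := by
    ext z
    constructor
    · rintro ⟨h1, h2⟩
      refine ⟨h1, ?_⟩
      show M * ‖z - x‖ ^ k < |D.indicator f z - p z|
      rw [Set.indicator_of_mem h1]; exact h2
    · rintro ⟨h1, h2⟩
      refine ⟨h1, ?_⟩
      have h2 : M * ‖z - x‖ ^ k < |D.indicator f z - p z| := h2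
      rwa [Set.indicator_of_mem h1] at h2
  rw [e]
  have h1 : Continuous fun z : Euc n => M * ‖z - x‖ ^ k := by fun_prop
  have h2 := meas_indicator hD hf
  have h3 : Measurable fun z => |D.indicator f z - p z| := (h2.sub hp.measurable).abs
  exact hD.inter (measurableSet_lt h1.measurable h3)

lemma value_eq {n k : ℕ} (hk : 0 < k) {D : Set (Euc n)} (hD : MeasurableSet D) {f : Euc n → ℝ}
    (hf : Measurable (D.restrict f)) {p : Euc n → ℝ} {x : Euc n}
    (h : HasApproxTaylorAt k D f x p)
    (hdens : ∀ a b : ℚ, (a:ℝ) < f x → f x < b →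
      DensityOneAt (D ∩ (D.indicator f) ⁻¹' (Set.Ioo (a:ℝ) b)) x) : p x = f x := by
  by_contra hne
  obtain ⟨_, hp, M, hM, hz⟩ := h
  have hpc := hp.smooth.continuous
  set c : ℝ := |f x - p x| / 3 with hc
  have hc0 : 0 < c := by
    have : f x - p x ≠ 0 := fun h0 => hne (sub_eq_zero.1 h0).symm
    have := abs_pos.2 this
    positivity
  obtain ⟨a, ha1, ha2⟩ := exists_rat_btwn (show f x - c < f x by linarith)
  obtain ⟨b, hb1, hb2⟩ := exists_rat_btwn (show f x < f x + c by linarith)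
  set Q := D ∩ (D.indicator f) ⁻¹' (Set.Ioo (a:ℝ) b) with hQ
  have hQm : MeasurableSet Q := hD.inter (meas_indicator hD hf measurableSet_Ioo)
  have hQd : DensityOneAt Q x := hdens a b ha2 hb1
  set T := {z | z ∈ D ∧ M * ‖z - x‖ ^ k < |f z - p z|} with hT
  have hTm : MeasurableSet T := meas_bad hD hf hpc x M
  have hTd : DensityOneAt Tᶜ x := hz
  obtain ⟨δ₁, hδ₁, H₁⟩ := hQd.compl_small hQm (η := 1/3) (by norm_num)
  obtain ⟨δ₂, hδ₂, H₂⟩ := hTd.compl_small hTm.compl (η := 1/3) (by norm_num)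
  have ev1 : ∀ᶠ z in nhds x, |p z - p x| < c := by
    have : Continuous fun z => |p z - p x| := by fun_prop
    apply this.continuousAt.eventually_lt_const
    simpa using hc0
  have ev2 : ∀ᶠ z in nhds x, M * ‖z - x‖ ^ k < c := by
    have : Continuous fun z : Euc n => M * ‖z - x‖ ^ k := by fun_prop
    apply this.continuousAt.eventually_lt_const
    simpa [hk.ne'] using hc0
  obtain ⟨δ₃, hδ₃, H₃⟩ := Metric.eventually_nhds_iff.1 (ev1.and ev2)
  set r := min δ₁ (min δ₂ δ₃) / 2 with hr
  have hr0 : 0 < r := by positivity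
  have hmin : min δ₁ (min δ₂ δ₃) = 2 * r := by rw [hr]; ring
  have r1 : r < δ₁ := by have := min_le_left δ₁ (min δ₂ δ₃); linarith
  have r2 : r < δ₂ := by
    have := (min_le_right δ₁ (min δ₂ δ₃)).trans (min_le_left _ _); linarith
  have r3 : r < δ₃ := by
    have := (min_le_right δ₁ (min δ₂ δ₃)).trans (min_le_right _ _); linarith
  have hcov : ball x r ⊆ (Qᶜ ∩ ball x r) ∪ (Tᶜᶜ ∩ ball x r) := by
    intro z hzb
    by_cases hzQ : z ∈ Q
    · right
      refine ⟨?_, hzb⟩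
      rw [compl_compl]
      obtain ⟨hzD, hzI⟩ := hzQ
      refine ⟨hzD, ?_⟩
      have hzI : D.indicator f z ∈ Set.Ioo (a:ℝ) b := hzI
      rw [Set.indicator_of_mem hzD] at hzI
      obtain ⟨g1, g2⟩ := H₃ (lt_trans hzb r3)
      have k1 : |f z - f x| < c := by
        rw [abs_lt]; constructor <;> linarith [hzI.1, hzI.2]
      have k2 : |f x - p x| ≤ |f z - f x| + |f z - p z| + |p z - p x| := by
        have : f x - p x = -(f z - f x) + (f z - p z) + (p z - p x) := by ring
        rw [this]
        refine (abs_add_three _ _ _).trans ?_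
        rw [abs_neg]
      have : |f x - p x| = 3 * c := by rw [hc]; ring
      linarith
    · left; exact ⟨hzQ, hzb⟩
  have hle := (measure_mono (μ := volume) hcov).trans ((measure_union_le _ _).trans
    (add_le_add (H₁ r hr0 r1) (H₂ r hr0 r2)))
  rw [← add_mul, ← ENNReal.ofReal_add (by norm_num) (by norm_num)] at hle
  have hlt : ENNReal.ofReal (1/3 + 1/3) * volume (ball x r) < 1 * volume (ball x r) := by
    apply ENNReal.mul_lt_mul_left (vol_ball_pos x hr0) (vol_ball_top x r)
    rw [ENNReal.ofReal_lt_one]; norm_num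
  rw [one_mul] at hlt
  exact absurd hle (not_le.2 hlt)

lemma mem_ES_of {n k : ℕ} {D : Set (Euc n)} (hD : MeasurableSet D) {f : Euc n → ℝ}
    (hf : Measurable (D.restrict f)) {p : Euc n → ℝ} {x : Euc n} (hx : x ∈ D)
    (h : HasApproxTaylorAt k D f x p) (hpx : p x = f x) {η : ℝ} (hη : 0 < η) :
    ∃ N : ℕ, x ∈ ES k D f η ((N:ℝ) + 1) := by
  obtain ⟨hd, hp, M, hM, hz⟩ := h
  have hpc := hp.smooth.continuous
  have hTm := meas_bad (k := k) hD hf hpc x M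
  set T := {z | z ∈ D ∧ M * ‖z - x‖ ^ k < |f z - p z|} with hT
  have hTd : DensityOneAt Tᶜ x := hz
  obtain ⟨δ₁, hδ₁, H₁⟩ := hd.compl_small hD (η := η/2) (by positivity)
  obtain ⟨δ₂, hδ₂, H₂⟩ := hTd.compl_small hTm.compl (η := η/2) (by positivity)
  obtain ⟨S, hS⟩ := (isCompact_closedBall x (5:ℝ)).exists_bound_of_continuousOn hpc.continuousOn
  obtain ⟨N, hN⟩ := exists_nat_gt (max (max ‖x‖ S) (max M (max (1/δ₁) (1/δ₂))))
  simp only [max_lt_iff] at hN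
  obtain ⟨⟨n1, n2⟩, n3, n4, n5⟩ := hN
  have hN0 : (0:ℝ) < (N:ℝ) := hM.trans n3
  refine ⟨N, hx, by linarith, p, hp, hpx, fun z hz => ?_, fun r hr hrN => ?_⟩
  · have := hS z hz
    rw [Real.norm_eq_abs] at this
    linarith
  · have q : ∀ δ : ℝ, 0 < δ → 1 / δ < N → r < δ := by
      intro δ hδ h
      have : 1 / ((N:ℝ) + 1) < δ := by
        rw [div_lt_iff₀ hδ] at h
        rw [div_lt_iff₀ (by positivity)]
        nlinarith
      linarith
    have hsub : badset k D f x p ((N:ℝ) + 1) ∩ ball x r ⊆ (Dᶜ ∩ ball x r) ∪ (Tᶜᶜ ∩ ball x r) := by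
      rintro z ⟨hz1, hz2⟩
      by_cases hzD : z ∈ D
      · right
        refine ⟨?_, hz2⟩
        rw [compl_compl]
        refine ⟨hzD, ?_⟩
        rcases hz1 with h | h
        · exact (h hzD).elim
        · refine lt_of_le_of_lt ?_ h
          gcongr
          linarith
      · left; exact ⟨hzD, hz2⟩
    refine (measure_mono hsub).trans ((measure_union_le _ _).trans
      ((add_le_add (H₁ r hr (q _ hδ₁ n4)) (H₂ r hr (q _ hδ₂ n5))).trans (le_of_eq ?_)))
    rw [← add_mul, ← ENNReal.ofReal_add (by positivity) (by positivity)]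
    congr 2
    ring

lemma dir12 (n k : ℕ) (hk : 0 < k)
    (D : Set (Euc n)) (hD : MeasurableSet D) (hDfin : volume D < ⊤)
    (f : Euc n → ℝ) (hf : Measurable (D.restrict f))
    (H : ∀ᵐ x₀ ∂(volume.restrict D), ∃ p : Euc n → ℝ, HasApproxTaylorAt k D f x₀ p)
    (ε : ℝ) (hε : 0 < ε) : ∃ M : ℝ, 0 < M ∧ ∃ u : Euc n → ℝ, MemLip n k M u ∧
      volume {x | x ∈ D ∧ u x ≠ f x} < ENNReal.ofReal ε := by
  obtain ⟨η, hη, HW⟩ := ES_whitney n k hk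
  have hdens : ∀ᵐ x, ∀ q : ℚ × ℚ, x ∈ D ∩ (D.indicator f) ⁻¹' (Set.Ioo (q.1:ℝ) q.2) →
      DensityOneAt (D ∩ (D.indicator f) ⁻¹' (Set.Ioo (q.1:ℝ) q.2)) x := by
    rw [ae_all_iff]
    intro q
    exact (ae_restrict_iff' (hD.inter (meas_indicator hD hf measurableSet_Ioo))).1 (density_ae _)
  rw [ae_restrict_iff' hD] at H
  have hmem : ∀ᵐ x, x ∈ D → x ∈ ⋃ N : ℕ, ES k D f η ((N:ℝ) + 1) := by
    filter_upwards [H, hdens] with x hx1 hx2 hxD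
    obtain ⟨p, hp⟩ := hx1 hxD
    rw [Set.mem_iUnion]
    apply mem_ES_of hD hf hxD hp _ hη
    apply value_eq hk hD hf hp
    intro a b h1 h2
    apply hx2 (a, b)
    refine ⟨hxD, ?_⟩
    show D.indicator f x ∈ Set.Ioo (a:ℝ) b
    rw [Set.indicator_of_mem hxD]
    exact ⟨h1, h2⟩
  have hmono : Monotone fun N : ℕ => ES k D f η ((N:ℝ) + 1) := by
    intro N N' h
    apply ES_mono (by positivity)
    have : (N:ℝ) ≤ N' := by exact_mod_cast h
    linarith
  have hvolD : volume D ≤ ⨆ N : ℕ, volume (ES k D f η ((N:ℝ) + 1)) := by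
    rw [← hmono.measure_iUnion]
    exact measure_mono_ae hmem
  have hε' : ENNReal.ofReal ε ≠ 0 := by simpa using hε
  obtain ⟨N, hN⟩ : ∃ N : ℕ, volume D < volume (ES k D f η ((N:ℝ) + 1)) + ENNReal.ofReal ε := by
    by_contra hcon
    push Not at hcon
    have h1 : (⨆ N : ℕ, volume (ES k D f η ((N:ℝ) + 1))) + ENNReal.ofReal ε ≤ volume D := by
      rw [ENNReal.iSup_add]
      exact iSup_le hcon
    have h2 : volume D + ENNReal.ofReal ε ≤ volume D := (add_le_add_left hvolD _).trans h1
    exact absurd h2 (not_le.2 (ENNReal.lt_add_right hDfin.ne hε'))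
  obtain ⟨B, hB, u, hu, hua⟩ := HW D f ((N:ℝ) + 1) (by positivity)
  refine ⟨B, hB, u, hu, ?_⟩
  set G := {x | x ∈ D ∧ u x = f x} with hG
  have hGm : MeasurableSet G := meas_eqset hD hf (hu.cont hk)
  have hsub : ES k D f η ((N:ℝ) + 1) ⊆ G := fun x hx => ⟨hx.1, hua x hx⟩
  have e1 : D ∩ G = G := Set.inter_eq_right.2 fun x hx => hx.1
  have e2 : D \ G = {x | x ∈ D ∧ u x ≠ f x} := by
    ext x
    constructor
    · rintro ⟨h1, h2⟩
      exact ⟨h1, fun h => h2 ⟨h1, h⟩⟩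
    · rintro ⟨h1, h2⟩
      exact ⟨h1, fun h => h2 h.2⟩
  have h3 := measure_inter_add_sdiff (μ := volume) D hGm
  rw [e1, e2] at h3
  have hGfin : volume G ≠ ⊤ := ne_top_of_le_ne_top hDfin.ne (measure_mono fun x hx => hx.1)
  have h4 : volume G + volume {x | x ∈ D ∧ u x ≠ f x} < volume G + ENNReal.ofReal ε := by
    rw [h3]
    exact lt_of_lt_of_le hN (add_le_add_left (measure_mono hsub) _)
  exact (ENNReal.add_lt_add_iff_left hGfin).1 h4

/-- **Theorem 1.2** (abelian case). For `D` of finite measure, `f : D → ℝ` has an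
approximate `(k−1)`-Taylor polynomial almost everywhere on `D` iff `f` admits a Lusin
approximation by functions in `Lip(k, ℝ^n)`. -/
theorem stmt1 (n : ℕ) (hn : 0 < n) (k : ℕ) (hk : 0 < k)
    (D : Set (Euc n)) (hD : MeasurableSet D) (hDfin : volume D < ⊤)
    (f : Euc n → ℝ) (hf : Measurable (D.restrict f)) :
    (∀ᵐ x₀ ∂(volume.restrict D), ∃ p : Euc n → ℝ, HasApproxTaylorAt k D f x₀ p) ↔
    (∀ ε : ℝ, 0 < ε → ∃ M : ℝ, 0 < M ∧ ∃ u : Euc n → ℝ, MemLip n k M u ∧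
      volume {x | x ∈ D ∧ u x ≠ f x} < ENNReal.ofReal ε) := by
  exact ⟨fun H ε hε => dir12 n k hk D hD hDfin f hf H ε hε, dir21 n k hk D hD f hf⟩
end
end

section
/- (De Giorgi lemma.) Let n and k be positive integers and A > 0. Then there exists a constant C > 0, depending only on n, k and A, with the following property: for every x₀ ∈ ℝ^n, every r > 0, every measurable set E contained in the Euclidean ball B(x₀, r) with vol(E) ≥ A r^n, every polynomial function P : ℝ^n → ℝ of degree at most k, and every multi-index α, one has |D^α P(x₀)| ≤ (C / r^{n+|α|}) ∫_E |P(y)| dy. -/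
open MeasureTheory Metric Filter

noncomputable section

section
open MvPolynomial

lemma aux_hasDeriv {n : ℕ} (i : Fin n) (p : MvPolynomial (Fin n) ℝ) (x : Euc n) :
    HasLineDerivAt ℝ (fun x : Euc n => eval (fun i => x i) p) (eval (fun i => x i) (pderiv i p)) x
      (EuclideanSpace.single i 1) := by
  induction p using MvPolynomial.induction_on with
  | C a => simpa [HasLineDerivAt] using hasDerivAt_const (0:ℝ) a
  | add p q hp hq => 
    unfold HasLineDerivAt at *
    simp only [map_add]
    exact hp.add hq
  | mul_X p j hp =>
    have hX : HasDerivAt (fun t : ℝ => (x + t • (EuclideanSpace.single i (1:ℝ) : Euc n)) j)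
        (if j = i then 1 else 0) 0 := by
      by_cases h : j = i
      · subst h
        simpa using (hasDerivAt_id (0:ℝ)).const_add (x j)
      · simpa [h] using hasDerivAt_const (0:ℝ) (x j)
    unfold HasLineDerivAt at *
    have := hp.mul hX
    simp only [map_mul, eval_X, pderiv_mul, map_add, pderiv_X]
    refine (this.congr_deriv ?_ : HasDerivAt _ _ _)
    by_cases h : j = i
    · subst h; simp
    · simp [h]

lemma aux_iterD {n : ℕ} (L : List (Fin n)) (p : MvPolynomial (Fin n) ℝ) :
    iterD L (fun x : Euc n => eval (fun i => x i) p) =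
      fun x : Euc n => eval (fun i => x i) (L.foldr (fun i q => pderiv i q) p) := by
  induction L with
  | nil => rfl
  | cons i L ih =>
    funext x
    simp only [iterD, ih, pd, List.foldr_cons]
    exact (aux_hasDeriv i _ x).lineDeriv

lemma aux_scale {n : ℕ} (L : List (Fin n)) (P : Euc n → ℝ) (x₀ : Euc n) (r : ℝ) :
    iterD L (fun y => P (x₀ + r • y)) = fun y => r ^ L.length * iterD L P (x₀ + r • y) := by
  induction L with
  | nil => simp [iterD]
  | cons i L ih =>
    funext y
    simp only [iterD, ih, pd, List.length_cons, lineDeriv]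
    have := deriv_comp_mul_left r (fun t : ℝ => iterD L P (x₀ + r • y + t • EuclideanSpace.single i 1)) 0
    simp only [mul_zero, smul_eq_mul] at this
    rw [deriv_const_mul_field, pow_succ, mul_assoc, ← this]
    simp [smul_add, smul_smul, add_assoc]

lemma aux_deg_pderiv {n : ℕ} (i : Fin n) (p : MvPolynomial (Fin n) ℝ) (k : ℕ)
    (h : p.totalDegree ≤ k + 1) : (pderiv i p).totalDegree ≤ k := by
  refine Finset.sup_le fun m hm => ?_
  rw [mem_support_iff, coeff_pderiv] at hm
  have h2 := le_totalDegree (mem_support_iff.2 (left_ne_zero_of_mul hm))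
  have h3 : ((m + Finsupp.single i 1).sum fun _ e => e) = (m.sum fun _ e => e) + 1 := by
    rw [Finsupp.sum_add_index' (by simp) (by simp)]; simp
  omega

lemma aux_foldr_zero {n : ℕ} (L : List (Fin n)) (p : MvPolynomial (Fin n) ℝ) :
    ∀ k, p.totalDegree ≤ k → (k < L.length → L.foldr (fun i q => pderiv i q) p = 0) ∧
      (L.foldr (fun i q => pderiv i q) p).totalDegree ≤ k - L.length := by
  induction L with
  | nil => intro k hk; simpa using hk
  | cons i L ih =>
    intro k hk
    obtain ⟨h1, h2⟩ := ih k hk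
    simp only [List.foldr_cons, List.length_cons]
    by_cases h : k < L.length
    · simp [h1 h]
    by_cases h' : k = L.length
    · have : (L.foldr (fun i q => pderiv i q) p).totalDegree = 0 := by omega
      rw [totalDegree_eq_zero_iff_eq_C] at this
      rw [this]; simp
    · exact ⟨fun h => by omega, aux_deg_pderiv i _ _ (by omega)⟩

lemma aux_len {n : ℕ} (α : Fin n → ℕ) : (multiList n α).length = mdeg α := by
  simp [multiList, mdeg, List.length_flatMap, ← Fin.sum_univ_def]

lemma aux_bind {n : ℕ} (p : MvPolynomial (Fin n) ℝ) (k : ℕ) (h : p.totalDegree ≤ k)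
    (x : Fin n → ℝ) (r : ℝ) : (bind₁ (fun i => C (x i) + C r * X i) p).totalDegree ≤ k := by
  rw [bind₁, aeval_def, eval₂_eq]
  refine (totalDegree_finsetSum _ _).trans (Finset.sup_le fun d hd => ?_)
  refine (totalDegree_mul _ _).trans ?_
  have h1 : totalDegree ((algebraMap ℝ (MvPolynomial (Fin n) ℝ)) (coeff d p)) = 0 := by
    simp [algebraMap_eq]
  rw [h1, zero_add]
  refine (totalDegree_finsetProd _ _).trans ?_
  refine le_trans ?_ ((le_totalDegree hd).trans h)
  refine Finset.sum_le_sum fun i _ => ?_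
  refine (totalDegree_pow _ _).trans ?_
  have : (C (x i) + C r * X i : MvPolynomial (Fin n) ℝ).totalDegree ≤ 1 := by
    refine (totalDegree_add _ _).trans ?_
    refine max_le (by simp) ((totalDegree_mul _ _).trans (by simp))
  nlinarith [Nat.mul_le_mul_left (d i) this]

lemma aux_null (n : ℕ) (p : MvPolynomial (Fin n) ℝ) (hp : p ≠ 0) :
    volume {x : Fin n → ℝ | eval x p = 0} = 0 := by
  induction n with
  | zero =>
    convert measure_empty (μ := (volume : Measure (Fin 0 → ℝ)))
    ext x
    simp only [Set.mem_ofPred_eq, Set.mem_empty_iff_false, iff_false]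
    intro h
    apply hp
    rw [eq_C_of_isEmpty p] at h ⊢
    simp at h
    simp [h]
  | succ n ih =>
    have hq : finSuccEquiv ℝ n p ≠ 0 := by simpa using hp
    obtain ⟨m, hm⟩ : ∃ m, (finSuccEquiv ℝ n p).coeff m ≠ 0 := by
      by_contra! h
      exact hq (Polynomial.ext (by simpa using h))
    have h1 := ih _ hm
    have hmeas : MeasurableSet {x : Fin (n+1) → ℝ | eval x p = 0} :=
      (isClosed_eq (MvPolynomial.continuous_eval p) continuous_const).measurableSet
    have e := (volume_preserving_piFinSuccAbove (fun _ : Fin (n + 1) => ℝ) 0).symm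
    rw [← e.measure_preimage hmeas.nullMeasurableSet]
    have hm2 := e.measurable hmeas
    rw [Measure.volume_eq_prod] at *
    have hsw := (Measure.measurePreserving_swap (μ := (volume : Measure (Fin n → ℝ)))
      (ν := (volume : Measure ℝ)))
    rw [← hsw.measure_preimage hm2.nullMeasurableSet,
      Measure.measure_prod_null (hsw.measurable hm2)]
    have h2 : ∀ᵐ s : Fin n → ℝ, eval s ((finSuccEquiv ℝ n p).coeff m) ≠ 0 := by
      rw [ae_iff]; simpa using h1
    filter_upwards [h2] with s hs
    have hne : Polynomial.map (eval s) (finSuccEquiv ℝ n p) ≠ 0 := by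
      intro h
      apply hs
      rw [← Polynomial.coeff_map, h]; simp
    refine measure_mono_null ?_ ((Polynomial.map (eval s) (finSuccEquiv ℝ n p)).roots.toFinset.finite_toSet.measure_zero volume)
    intro y hy
    have hy' : eval (Fin.cons y s : Fin (n+1) → ℝ) p = 0 := by
      simpa [MeasurableEquiv.piFinSuccAbove, Fin.insertNthEquiv] using hy
    rw [eval_eq_eval_mv_eval'] at hy'
    simp [hne, hy']

lemma aux_null' (n : ℕ) (p : MvPolynomial (Fin n) ℝ) (hp : p ≠ 0) :
    volume {x : Euc n | eval (fun i => x i) p = 0} = 0 := by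
  have hmeas : MeasurableSet {x : Fin n → ℝ | eval x p = 0} :=
    (isClosed_eq (MvPolynomial.continuous_eval p) continuous_const).measurableSet
  have := (PiLp.volume_preserving_ofLp (Fin n)).measure_preimage hmeas.nullMeasurableSet
  rw [aux_null n p hp] at this
  exact this

lemma aux_cont {n : ℕ} (p : MvPolynomial (Fin n) ℝ) :
    Continuous fun x : Euc n => eval (fun i => x i) p :=
  (MvPolynomial.continuous_eval p).comp (by fun_prop)

lemma aux_local (n : ℕ) (A : ℝ) (hA : 0 < A) (p : MvPolynomial (Fin n) ℝ) (hp : p ≠ 0) :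
    ∃ δ : ℝ, 0 < δ ∧ ∀ E : Set (Euc n), MeasurableSet E → E ⊆ ball 0 1 →
      ENNReal.ofReal A ≤ volume E → ∀ g : Euc n → ℝ, Continuous g →
        (∀ x ∈ ball (0 : Euc n) 1, |g x - eval (fun i => x i) p| ≤ δ) →
        δ * (A / 2) ≤ ∫ x in E, |g x| := by
  set f : Euc n → ℝ := fun x => eval (fun i => x i) p with hf
  have hfc : Continuous f := aux_cont p
  let S : ℕ → Set (Euc n) := fun m => ball 0 1 ∩ {x | |f x| < 1 / ((m : ℝ) + 1)}
  have hSm : ∀ m, MeasurableSet (S m) := fun m =>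
    (isOpen_ball.inter (isOpen_lt (hfc.abs) continuous_const)).measurableSet
  have hanti : Antitone S := by
    intro a b hab x hx
    have hx2 : |f x| < 1 / ((b : ℝ) + 1) := hx.2
    refine ⟨hx.1, Set.mem_ofPred.2 (lt_of_lt_of_le hx2 ?_)⟩
    have : (a : ℝ) ≤ b := by exact_mod_cast hab
    gcongr
  have hball : ∀ E : Set (Euc n), E ⊆ ball 0 1 → volume E ≠ ⊤ := fun E hE =>
    ((measure_mono hE).trans_lt measure_ball_lt_top).ne
  have hlim := tendsto_measure_iInter_atTop (μ := volume) (fun m => (hSm m).nullMeasurableSet) hanti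
    ⟨0, hball _ Set.inter_subset_left⟩
  have h0 : volume (⋂ m, S m) = 0 := by
    refine measure_mono_null ?_ (aux_null' n p hp)
    intro x hx
    rw [Set.mem_iInter] at hx
    by_contra h
    have h' : 0 < |f x| := abs_pos.2 h
    obtain ⟨m, hm⟩ := exists_nat_one_div_lt h'
    exact absurd (hx m).2 (not_lt.2 hm.le)
  rw [h0] at hlim
  have hpos : (0 : ENNReal) < ENNReal.ofReal (A / 2) := by simpa using hA
  obtain ⟨m, hm⟩ := (hlim.eventually (gt_mem_nhds hpos)).exists
  refine ⟨1 / ((m : ℝ) + 1) / 2, by positivity, ?_⟩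
  set d : ℝ := 1 / ((m : ℝ) + 1) with hd
  have hdpos : 0 < d := by positivity
  intro E hE hEb hEA g hg hgf
  have hF : MeasurableSet (E \ S m) := hE.diff (hSm m)
  have hint : IntegrableOn (fun x => |g x|) E := by
    have : IntegrableOn (fun x => |g x|) (closedBall 0 1) :=
      hg.abs.continuousOn.integrableOn_compact (isCompact_closedBall _ _)
    exact this.mono_set (hEb.trans ball_subset_closedBall)
  have h1 : ∫ x in E \ S m, |g x| ≤ ∫ x in E, |g x| :=
    setIntegral_mono_set hint (ae_of_all _ fun x => abs_nonneg _)
      (Set.sdiff_subset.eventuallyLE)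
  have h2 : d / 2 * volume.real (E \ S m) ≤ ∫ x in E \ S m, |g x| := by
    refine setIntegral_ge_of_const_le_real hF (hball _ (Set.sdiff_subset.trans hEb)) ?_
      (hint.mono_set Set.sdiff_subset)
    intro x hx
    have hxb := hEb hx.1
    have hx2 : d ≤ |f x| := by
      by_contra h
      exact hx.2 ⟨hxb, not_le.1 h⟩
    have h3 := hgf x hxb
    have h4 : |f x| ≤ |g x| + |g x - f x| := by
      rw [abs_sub_comm]
      have := abs_add_le (g x) (f x - g x)
      simpa using this
    have h5 : |g x - f x| ≤ d / 2 := h3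
    linarith
  have h3 : A / 2 ≤ volume.real (E \ S m) := by
    have h4 : A ≤ volume.real E := by
      rw [Measure.real]
      exact (ENNReal.ofReal_le_iff_le_toReal (hball _ hEb)).1 hEA
    have h5 : volume.real (S m) ≤ A / 2 := by
      rw [Measure.real]
      exact ENNReal.toReal_le_of_le_ofReal (by positivity) hm.le
    have h6 := le_measureReal_sdiff (μ := (volume : Measure (Euc n))) (s₁ := E) (s₂ := S m)
      (hball _ Set.inter_subset_left)
    linarith
  have h7 : d / 2 * (A / 2) ≤ d / 2 * volume.real (E \ S m) := by gcongr
  linarith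

lemma aux_compact (n : ℕ) (A : ℝ) (hA : 0 < A) (d : ℕ) (b : Fin d → MvPolynomial (Fin n) ℝ)
    (hb : LinearIndependent ℝ b) :
    ∃ c : ℝ, 0 < c ∧ ∀ w : Fin d → ℝ, ∀ E : Set (Euc n), MeasurableSet E → E ⊆ ball 0 1 →
      ENNReal.ofReal A ≤ volume E →
        c * ‖w‖ ≤ ∫ x in E, |eval (fun i => x i) (∑ j, w j • b j)| := by
  have key : ∃ c : ℝ, 0 < c ∧ ∀ w ∈ sphere (0 : Fin d → ℝ) 1, ∀ E : Set (Euc n),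
      MeasurableSet E → E ⊆ ball 0 1 → ENNReal.ofReal A ≤ volume E →
        c ≤ ∫ x in E, |eval (fun i => x i) (∑ j, w j • b j)| := by
    refine (isCompact_sphere (0 : Fin d → ℝ) 1).induction_on
      (p := fun T => ∃ c : ℝ, 0 < c ∧ ∀ w ∈ T, ∀ E : Set (Euc n),
      MeasurableSet E → E ⊆ ball 0 1 → ENNReal.ofReal A ≤ volume E →
        c ≤ ∫ x in E, |eval (fun i => x i) (∑ j, w j • b j)|) ?_ ?_ ?_ ?_
    · exact ⟨1, one_pos, by simp⟩
    · rintro s t hst ⟨c, hc, h⟩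
      exact ⟨c, hc, fun w hw => h w (hst hw)⟩
    · rintro s t ⟨c, hc, h⟩ ⟨c', hc', h'⟩
      refine ⟨min c c', lt_min hc hc', ?_⟩
      rintro w (hw | hw) E h1 h2 h3
      · exact (min_le_left _ _).trans (h w hw E h1 h2 h3)
      · exact (min_le_right _ _).trans (h' w hw E h1 h2 h3)
    · intro w hw
      have hne : (∑ j, w j • b j) ≠ 0 := by
        intro h
        have : w = 0 := funext (Fintype.linearIndependent_iff.1 hb w h)
        simp [this] at hw
      obtain ⟨δ, hδ, h⟩ := aux_local n A hA _ hne
      have hM : ∃ M : ℝ, 0 < M ∧ ∀ x ∈ ball (0 : Euc n) 1,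
          ∑ j, |eval (fun i => x i) (b j)| ≤ M := by
        have hc : Continuous fun x : Euc n => ∑ j, |eval (fun i => x i) (b j)| :=
          continuous_finsetSum _ fun j _ => (aux_cont (b j)).abs
        obtain ⟨M, hM⟩ := (isCompact_closedBall (0 : Euc n) 1).exists_bound_of_continuousOn
          hc.continuousOn
        refine ⟨max M 1, by positivity, fun x hx => ?_⟩
        exact (le_abs_self _).trans ((hM x (ball_subset_closedBall hx)).trans (le_max_left _ _))
      obtain ⟨M, hM0, hM⟩ := hM
      refine ⟨ball w (δ / M), mem_nhdsWithin_of_mem_nhds (ball_mem_nhds _ (by positivity)),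
        δ * (A / 2), by positivity, ?_⟩
      intro v hv E h1 h2 h3
      refine h E h1 h2 h3 _ (aux_cont _) ?_
      intro x hx
      have hvw : ∀ j, |v j - w j| ≤ δ / M := fun j => by
        have h4 := norm_le_pi_norm (v - w) j
        rw [mem_ball, dist_eq_norm] at hv
        exact h4.trans hv.le
      calc |eval (fun i => x i) (∑ j, v j • b j) - eval (fun i => x i) (∑ j, w j • b j)|
          = |∑ j, (v j - w j) * eval (fun i => x i) (b j)| := by
            simp [smul_eval, sub_mul, Finset.sum_sub_distrib]
        _ ≤ ∑ j, |(v j - w j) * eval (fun i => x i) (b j)| := Finset.abs_sum_le_sum_abs _ _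
        _ ≤ ∑ j, (δ / M) * |eval (fun i => x i) (b j)| := by
            refine Finset.sum_le_sum fun j _ => ?_
            rw [abs_mul]
            exact mul_le_mul_of_nonneg_right (hvw j) (abs_nonneg _)
        _ = (δ / M) * ∑ j, |eval (fun i => x i) (b j)| := by rw [Finset.mul_sum]
        _ ≤ (δ / M) * M := mul_le_mul_of_nonneg_left (hM x hx) (by positivity)
        _ = δ := by field_simp
  obtain ⟨c, hc, h⟩ := key
  refine ⟨c, hc, fun w E h1 h2 h3 => ?_⟩
  by_cases hw : w = 0
  · simp [hw]
  have hw' : 0 < ‖w‖ := norm_pos_iff.2 hw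
  have h4 := h (‖w‖⁻¹ • w) (by simp [norm_smul, hw'.ne']) E h1 h2 h3
  have h5 : ∀ x : Euc n, |eval (fun i => x i) (∑ j, (‖w‖⁻¹ • w) j • b j)| =
      ‖w‖⁻¹ * |eval (fun i => x i) (∑ j, w j • b j)| := by
    intro x
    have : (∑ j, (‖w‖⁻¹ • w) j • b j) = ‖w‖⁻¹ • ∑ j, w j • b j := by
      simp [Finset.smul_sum, smul_smul]
    rw [this, smul_eval, abs_mul, abs_of_pos (by positivity : 0 < ‖w‖⁻¹)]
  simp_rw [h5] at h4
  rw [integral_const_mul] at h4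
  calc c * ‖w‖ ≤ (‖w‖⁻¹ * ∫ x in E, |eval (fun i => x i) (∑ j, w j • b j)|) * ‖w‖ := by gcongr
    _ = _ := by field_simp

/-- The unit-ball case. -/
lemma aux_unit (n k : ℕ) (A : ℝ) (hA : 0 < A) :
    ∃ C : ℝ, 0 < C ∧ ∀ E : Set (Euc n), MeasurableSet E → E ⊆ ball 0 1 →
      ENNReal.ofReal A ≤ volume E → ∀ p : MvPolynomial (Fin n) ℝ, p.totalDegree ≤ k →
        ∀ α : Fin n → ℕ, |DJ α (fun x => eval (fun i => x i) p) 0| ≤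
          C * ∫ x in E, |eval (fun i => x i) p| := by
  let V := restrictTotalDegree (Fin n) ℝ k
  let b := Module.finBasis ℝ V
  have hb : LinearIndependent ℝ (fun j => (b j : MvPolynomial (Fin n) ℝ)) :=
    b.linearIndependent.map' V.subtype V.ker_subtype
  obtain ⟨c, hc, h⟩ := aux_compact n A hA _ _ hb
  have hT : ∀ L : List (Fin n), ∃ T : MvPolynomial (Fin n) ℝ →ₗ[ℝ] ℝ, ∀ p,
      iterD L (fun x : Euc n => eval (fun i => x i) p) 0 = T p := by
    intro L
    have h1 : ∃ U : MvPolynomial (Fin n) ℝ →ₗ[ℝ] MvPolynomial (Fin n) ℝ, ∀ p,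
        L.foldr (fun i q => pderiv i q) p = U p := by
      induction L with
      | nil => exact ⟨LinearMap.id, fun p => rfl⟩
      | cons i L ih =>
        obtain ⟨U, hU⟩ := ih
        exact ⟨(pderiv i).toLinearMap.comp U, fun p => by simp [hU]⟩
    obtain ⟨U, hU⟩ := h1
    refine ⟨(aeval (fun i => (0 : Euc n) i)).toLinearMap.comp U, fun p => ?_⟩
    rw [aux_iterD, hU]
    simp [aeval_eq_eval]
  choose T hT using hT
  let K : (Fin n → ℕ) → ℝ := fun α => ∑ j, |T (multiList n α) (b j)|
  have hK : ∀ α, 0 ≤ K α := fun α => Finset.sum_nonneg fun _ _ => abs_nonneg _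
  let K' : ℝ := ∑ α ∈ multiIdxLe n k, K α
  have hK' : 0 ≤ K' := Finset.sum_nonneg fun _ _ => hK _
  refine ⟨(K' + 1) / c, by positivity, ?_⟩
  intro E h1 h2 h3 p hp α
  have hI : 0 ≤ ∫ x in E, |eval (fun i => x i) p| := integral_nonneg fun _ => abs_nonneg _
  by_cases hα : k < mdeg α
  · have : DJ α (fun x : Euc n => eval (fun i => x i) p) 0 = 0 := by
      rw [DJ, aux_iterD, ((aux_foldr_zero (multiList n α) p k hp).1 (by rwa [aux_len]))]
      simp
    rw [this, abs_zero]
    positivity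
  · have hmem : α ∈ multiIdxLe n k := by
      simp only [multiIdxLe, Finset.mem_filter, Fintype.mem_piFinset, Finset.mem_range]
      refine ⟨fun i => ?_, by omega⟩
      have : α i ≤ mdeg α := Finset.single_le_sum (f := α) (fun _ _ => Nat.zero_le _) (Finset.mem_univ i)
      omega
    let w := b.equivFun ⟨p, (mem_restrictTotalDegree _ _ _).2 hp⟩
    have hw : p = ∑ j, w j • (b j : MvPolynomial (Fin n) ℝ) := by
      have := congrArg (V.subtype) (b.sum_equivFun ⟨p, (mem_restrictTotalDegree _ _ _).2 hp⟩)
      rw [map_sum] at this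
      exact this.symm
    have h4 := h w E h1 h2 h3
    rw [← hw] at h4
    have h5 : |DJ α (fun x : Euc n => eval (fun i => x i) p) 0| ≤ K α * ‖w‖ := by
      rw [DJ, hT]
      conv_lhs => rw [hw]
      rw [map_sum, Finset.sum_mul]
      refine (Finset.abs_sum_le_sum_abs _ _).trans (Finset.sum_le_sum fun j _ => ?_)
      rw [map_smul, smul_eq_mul, abs_mul, mul_comm]
      exact mul_le_mul_of_nonneg_left (norm_le_pi_norm w j) (abs_nonneg _)
    have h6 : K α ≤ K' := Finset.single_le_sum (fun a _ => hK a) hmem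
    calc _ ≤ K α * ‖w‖ := h5
      _ ≤ (K' + 1) * ‖w‖ := by gcongr; linarith
      _ = (K' + 1) / c * (c * ‖w‖) := by field_simp
      _ ≤ _ := by gcongr

end

/-- **De Giorgi's lemma.** There is `C = C(n,k,A) > 0` such that for every ball
`B(x₀,r)`, every measurable `E ⊆ B(x₀,r)` with `vol(E) ≥ A r^n`, every polynomial `P`
of degree at most `k` and every multi-index `α`,
`|D^α P(x₀)| ≤ (C / r^{n+|α|}) ∫_E |P|`. -/
theorem stmt3 (n : ℕ) (hn : 0 < n) (k : ℕ) (hk : 0 < k) (A : ℝ) (hA : 0 < A) :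
    ∃ C : ℝ, 0 < C ∧ ∀ (x₀ : Euc n) (r : ℝ), 0 < r →
      ∀ E : Set (Euc n), MeasurableSet E → E ⊆ ball x₀ r →
        ENNReal.ofReal (A * r ^ n) ≤ volume E →
        ∀ P : Euc n → ℝ, IsPolyFun n k P →
          ∀ α : Fin n → ℕ,
            |DJ α P x₀| ≤ C / r ^ (n + mdeg α) * ∫ y in E, |P y| := by
  obtain ⟨C, hC, h⟩ := aux_unit n k A hA
  refine ⟨C, hC, ?_⟩
  rintro x₀ r hr E hE hEb hEA P ⟨p, hp, hP⟩ α
  let q := MvPolynomial.bind₁ (fun i => MvPolynomial.C (x₀ i) +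
    MvPolynomial.C r * MvPolynomial.X i) p
  have hq : ∀ y : Euc n, MvPolynomial.eval (fun i => y i) q = P (x₀ + r • y) := by
    intro y
    rw [hP]
    simp only [q, MvPolynomial.eval, MvPolynomial.eval₂Hom_bind₁]
    simp
  have hqd : q.totalDegree ≤ k := aux_bind p k hp _ r
  let φ : Euc n → Euc n := fun y => x₀ + r • y
  have hφ : Measurable φ := by fun_prop
  have hvol : ∀ F : Set (Euc n), volume (φ ⁻¹' F) = ENNReal.ofReal ((r ^ n)⁻¹) * volume F := by
    intro F
    have h1 : φ ⁻¹' F = (fun y : Euc n => r • y) ⁻¹' ((fun z => x₀ + z) ⁻¹' F) := rfl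
    rw [h1, Measure.addHaar_preimage_smul _ hr.ne', measure_preimage_add]
    simp [abs_of_pos hr]
  have hint : ∫ y in φ ⁻¹' E, |P (x₀ + r • y)| = (r ^ n)⁻¹ * ∫ y in E, |P y| := by
    rw [← integral_indicator (hφ hE), ← integral_indicator hE]
    have h1 : (φ ⁻¹' E).indicator (fun y => |P (x₀ + r • y)|) =
        fun y => (fun z => E.indicator (fun y => |P y|) (x₀ + z)) (r • y) := by
      funext y
      simp only [Set.indicator]
      rfl
    rw [h1, Measure.integral_comp_smul, integral_add_left_eq_self]
    simp [abs_of_pos hr]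
  have h2 := h (φ ⁻¹' E) (hφ hE) ?_ ?_ q hqd α
  · simp only [hq] at h2
    rw [hint, DJ, aux_scale, aux_len, abs_mul, abs_of_pos (pow_pos hr _)] at h2
    simp only [smul_zero, add_zero] at h2
    have h3 : |DJ α P x₀| = (r ^ mdeg α)⁻¹ * (r ^ mdeg α * |iterD (multiList n α) P x₀|) := by
      rw [DJ]; field_simp
    rw [h3]
    calc _ ≤ (r ^ mdeg α)⁻¹ * (C * ((r ^ n)⁻¹ * ∫ y in E, |P y|)) := by gcongr
      _ = _ := by rw [pow_add]; field_simp
  · intro y hy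
    have := hEb hy
    simp only [mem_ball, dist_eq_norm, φ, add_sub_cancel_left, norm_smul, Real.norm_eq_abs,
      abs_of_pos hr] at this
    simp only [mem_ball, dist_zero_right]
    nlinarith
  · rw [hvol]
    calc ENNReal.ofReal A = ENNReal.ofReal ((r ^ n)⁻¹) * ENNReal.ofReal (A * r ^ n) := by
          rw [← ENNReal.ofReal_mul (by positivity)]
          congr 1
          field_simp
      _ ≤ _ := by gcongr
end
end
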